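/- (Dong's lemma for multiple locality.) Let a¹(𝐳),…,aʳ(𝐳) be multiply local homogeneous End(E)-valued distributions; in particular a¹(𝐳), a²(𝐳) are local. Then for every 𝐧∈K², the family of distributions a¹(𝐳)_(𝐧)a²(𝐳), a³(𝐳), …, aʳ(𝐳) is multiply local. -/

import Mathlib

open scoped BigOperators Classical

noncomputable section

namespace OPEA

variable (K : Type*) [Field K] [CharZero K]

/-- index pairs 𝐧 = (n, n̄) ∈ K² -/
abbrev Idx := K × K

def IsInt (x : K) : Prop := ∃ k : ℤ, (k : K) = x

def IsNegInt (x : K) : Prop := ∃ k : ℤ, k < 0 ∧ (k : K) = x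

/-- 𝕂̄ = {𝐧 ∈ K² | n − n̄ ∈ ℤ} -/
def Kbar (n : Idx K) : Prop := IsInt K (n.1 - n.2)

def IsIntPair (n : Idx K) : Prop := IsInt K n.1 ∧ IsInt K n.2

/-- generalized binomial coefficient C(x,k) -/
def gchoose (x : K) (k : ℕ) : K :=
  (∏ i ∈ Finset.range k, (x - (i : K))) / (k.factorial : K)

/-- (−1)^x for x an integer image in K (and 1 otherwise) -/
def negOnePow (x : K) : K :=
  if h : ∃ k : ℤ, (k : K) = x then (-1 : K) ^ h.choose else 1

variable (M : Type*) [AddCommGroup M] [Module K M]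

/-- M-valued distribution in one variable pair -/
abbrev Dist1 := Idx K → M

/-- M-valued distribution in two variable pairs -/
abbrev Dist2 := Idx K → Idx K → M

/-- M-valued distribution in r variable pairs -/
abbrev DistN (r : ℕ) := (Fin r → Idx K) → M

/-- membership in M[[𝐳]] -/
def IsPow1 (a : Dist1 K M) : Prop := ∀ n, a n ≠ 0 → IsNegInt K n.1 ∧ IsNegInt K n.2

/-- membership in M⌊𝐳⌋ -/
def InLat1 (a : Dist1 K M) : Prop :=
  ∃ S : Finset (Idx K), ∀ n, a n ≠ 0 →
    ∃ m ∈ S, IsNegInt K (n.1 - m.1) ∧ IsNegInt K (n.2 - m.2)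

/-- membership in M[[𝐳,𝐰]] -/
def IsPow2 (a : Dist2 K M) : Prop :=
  ∀ n k, a n k ≠ 0 →
    (IsNegInt K n.1 ∧ IsNegInt K n.2) ∧ (IsNegInt K k.1 ∧ IsNegInt K k.2)

/-- membership in M⌊𝐳,𝐰⌋ -/
def InLat2 (a : Dist2 K M) : Prop :=
  ∃ S : Finset (Idx K × Idx K), ∀ n k, a n k ≠ 0 →
    ∃ m ∈ S, (IsNegInt K (n.1 - m.1.1) ∧ IsNegInt K (n.2 - m.1.2)) ∧
      (IsNegInt K (k.1 - m.2.1) ∧ IsNegInt K (k.2 - m.2.2))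

/-- membership in M[[𝐳₁,…,𝐳ᵣ]] -/
def IsPowN {r : ℕ} (a : DistN K M r) : Prop :=
  ∀ n, a n ≠ 0 → ∀ i, IsNegInt K (n i).1 ∧ IsNegInt K (n i).2

/-- membership in M⌊𝐳₁,…,𝐳ᵣ⌋ -/
def InLatN {r : ℕ} (a : DistN K M r) : Prop :=
  ∃ S : Finset (Fin r → Idx K), ∀ n, a n ≠ 0 →
    ∃ m ∈ S, ∀ i, IsNegInt K ((n i).1 - (m i).1) ∧ IsNegInt K ((n i).2 - (m i).2)

/-- ∂_z -/
def dz (a : Dist1 K M) : Dist1 K M := fun n => (-n.1) • a (n.1 - 1, n.2)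

/-- ∂_z̄ -/
def dzb (a : Dist1 K M) : Dist1 K M := fun n => (-n.2) • a (n.1, n.2 - 1)

/-- ∂ in the first variable pair of a two-variable distribution (z-component) -/
def d1z (c : Dist2 K M) : Dist2 K M := fun n k => (-n.1) • c (n.1 - 1, n.2) k

/-- ∂ in the first variable pair of a two-variable distribution (z̄-component) -/
def d1zb (c : Dist2 K M) : Dist2 K M := fun n k => (-n.2) • c (n.1, n.2 - 1) k

/-- divided power d^{(x)} of an operator d, for a K-valued exponent x
(zero unless x ∈ ℕ) -/
def dPow {A : Type*} [AddCommGroup A] [Module K A] (d : A → A) (x : K) (a : A) : A :=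
  if h : ∃ j : ℕ, (j : K) = x then ((h.choose.factorial : K))⁻¹ • d^[h.choose] a else 0

/-- ∂_z^{(e_1)} ∂_z̄^{(e_2)} in the first variable pair -/
def ddPow2 (e : Idx K) (c : Dist2 K M) : Dist2 K M :=
  dPow K (d1z K M) e.1 (dPow K (d1zb K M) e.2 c)

/-- the diagonal map c(𝐳,𝐰) ↦ c(𝐰,𝐰) -/
def diag (c : Dist2 K M) : Dist1 K M :=
  fun n => ∑ᶠ m : Idx K, c m (n.1 - m.1 - 1, n.2 - m.2 - 1)

/-- multiplication by (𝐳−𝐰)^h (expansion in z>w), on coefficients;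
first index is 𝐳, second is 𝐰 -/
def zwPow (h : Idx K) (c : Dist2 K M) : Dist2 K M :=
  fun m k => ∑ᶠ i : ℕ × ℕ,
    ((-1 : K) ^ (i.1 + i.2) * gchoose K h.1 i.1 * gchoose K h.2 i.2) •
      c (m.1 + h.1 - i.1, m.2 + h.2 - i.2) (k.1 + i.1, k.2 + i.2)

/-- multiplication by ((𝐳−𝐰)_{w>z})^h = (−1)^h (𝐰−𝐳)^h (expansion in w>z) -/
def zwPowW (h : Idx K) (c : Dist2 K M) : Dist2 K M :=
  fun m k => ∑ᶠ i : ℕ × ℕ,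
    (negOnePow K (h.1 - h.2) * (-1 : K) ^ (i.1 + i.2) *
        gchoose K h.1 i.1 * gchoose K h.2 i.2) •
      c (m.1 + i.1, m.2 + i.2) (k.1 + h.1 - i.1, k.2 + h.2 - i.2)

/-- multiplication by (𝐱+𝐰)^N of a distribution d(𝐰,𝐱) (first index 𝐰, second 𝐱);
the result is indexed by (x-index, w-index) -/
def xwPow (N : Idx K) (d : Dist2 K M) : Dist2 K M :=
  fun m k => ∑ᶠ i : ℕ × ℕ, (gchoose K N.1 i.1 * gchoose K N.2 i.2) •
    d (k.1 + i.1, k.2 + i.2) (m.1 + N.1 - i.1, m.2 + N.2 - i.2)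

/-- multiplication by (𝐰+𝐱)^N of a distribution d(𝐰,𝐱) (first index 𝐰, second 𝐱);
the result is indexed by (x-index, w-index) -/
def wxPow (N : Idx K) (d : Dist2 K M) : Dist2 K M :=
  fun m k => ∑ᶠ i : ℕ × ℕ, (gchoose K N.1 i.1 * gchoose K N.2 i.2) •
    d (k.1 + N.1 - i.1, k.2 + N.2 - i.2) (m.1 + i.1, m.2 + i.2)

/-- multiplication by 𝐱^A 𝐰^B (𝐱+𝐰)^N of p(𝐰,𝐱); result indexed (x-index, w-index) -/
def tripleXW (A B N : Idx K) (p : Dist2 K M) : Dist2 K M :=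
  fun m k => ∑ᶠ l : ℕ × ℕ, (gchoose K N.1 l.1 * gchoose K N.2 l.2) •
    p (k.1 + B.1 + l.1, k.2 + B.2 + l.2) (m.1 + A.1 + N.1 - l.1, m.2 + A.2 + N.2 - l.2)

/-- multiplication by 𝐱^A 𝐰^B (𝐰+𝐱)^N of p(𝐰,𝐱); result indexed (x-index, w-index) -/
def tripleWX (A B N : Idx K) (p : Dist2 K M) : Dist2 K M :=
  fun m k => ∑ᶠ l : ℕ × ℕ, (gchoose K N.1 l.1 * gchoose K N.2 l.2) •
    p (k.1 + B.1 + N.1 - l.1, k.2 + B.2 + N.2 - l.2) (m.1 + A.1 + l.1, m.2 + A.2 + l.2)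

variable (E : Type*) [AddCommGroup E] [Module K E]

/-- End(E)-valued distributions in one variable pair -/
abbrev EDist1 := Dist1 K (Module.End K E)

/-- End(E)-valued distributions in two variable pairs -/
abbrev EDist2 := Dist2 K (Module.End K E)

/-- End(E)-valued distributions in r variable pairs -/
abbrev EDistN (r : ℕ) := DistN K (Module.End K E) r

def ev1 (a : EDist1 K E) (v : E) : Dist1 K E := fun n => a n v

def ev2 (c : EDist2 K E) (v : E) : Dist2 K E := fun n k => c n k v

def evN {r : ℕ} (c : EDistN K E r) (v : E) : DistN K E r := fun n => c n v

/-- a(𝐳) is a field -/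
def IsFieldD (a : EDist1 K E) : Prop := ∀ v, InLat1 K E (ev1 K E a v)

/-- a field in two variable pairs -/
def IsField2D (c : EDist2 K E) : Prop := ∀ v, InLat2 K E (ev2 K E c v)

/-- the Koszul sign (−1)^{pq} -/
def koszul (p q : ZMod 2) : K := if p = 1 ∧ q = 1 then (-1 : K) else 1

/-- the data (c^i, 𝐡_i) is an OPE of the homogeneous distributions a(𝐳), b(𝐳)
of parities pa, pb (all identities to be read applied to each vector of E) -/
def IsOPE (pa pb : ZMod 2) (a b : EDist1 K E) {r : ℕ}
    (c : Fin r → EDist2 K E) (h : Fin r → Idx K) : Prop :=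
  (∀ i, Kbar K (h i)) ∧ (∀ i, IsField2D K E (c i)) ∧
  (∀ v m k, a m (b k v) = ∑ i, zwPow K E (-(h i)) (ev2 K E (c i) v) m k) ∧
  (∀ v m k, koszul K pa pb • (b k (a m v)) =
      ∑ i, zwPowW K E (-(h i)) (ev2 K E (c i) v) m k)

/-- a(𝐳), b(𝐳) (homogeneous of parities pa, pb) are local -/
def IsLocal (pa pb : ZMod 2) (a b : EDist1 K E) : Prop :=
  ∃ (r : ℕ) (c : Fin r → EDist2 K E) (h : Fin r → Idx K), IsOPE K E pa pb a b c h

/-- the exponents of an OPE are reduced: 𝐡_i ∉ 𝐡_j + ℤ² for i ≠ j -/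
def ReducedExp {r : ℕ} (h : Fin r → Idx K) : Prop :=
  ∀ i j, i ≠ j → ¬ IsIntPair K (h i - h j)

/-- the product field a(𝐰)_{(𝐧)}b(𝐰) built from an OPE (c,h), applied to a vector v -/
def prodAt {r : ℕ} (c : Fin r → EDist2 K E) (h : Fin r → Idx K) (n : Idx K)
    (v : E) : Dist1 K E :=
  fun m => ∑ i, diag K E
    (ddPow2 K E ((h i).1 - 1 - n.1, (h i).2 - 1 - n.2) (ev2 K E (c i) v)) m

/-- s₁ : a(𝐳) ↦ a_{(−1,−1)}1 -/
def s1 (one : E) (a : EDist1 K E) : E := a ((-1 : K), (-1 : K)) one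

/-- the distribution d (to be thought of as a(𝐳)1) equals
Σ_{𝐢∈ℕ²} T^{(i)} T̄^{(ī)} (d_{(−1,−1)}) 𝐳^𝐢, i.e. a(𝐳) is creative -/
def CreativeD (T Tb : Module.End K E) (d : Dist1 K E) : Prop :=
  (∀ i : ℕ × ℕ, d (-(i.1 : K) - 1, -(i.2 : K) - 1) =
      ((i.1.factorial : K)⁻¹ * (i.2.factorial : K)⁻¹) •
        ((T ^ i.1) * (Tb ^ i.2)) (d ((-1 : K), (-1 : K)))) ∧
  (∀ n : Idx K, (¬ ∃ i : ℕ × ℕ, n = (-(i.1 : K) - 1, -(i.2 : K) - 1)) → d n = 0)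

/-- a(𝐳) is translation covariant for (T, T̄) -/
def TransCov (T Tb : Module.End K E) (a : EDist1 K E) : Prop :=
  (∀ n : Idx K, T * a n - a n * T = (-n.1) • a (n.1 - 1, n.2)) ∧
  (∀ n : Idx K, Tb * a n - a n * Tb = (-n.2) • a (n.1, n.2 - 1))

/-- translation covariance of a product field, per vector -/
def TransCovAt (T Tb : Module.End K E) (P : E → Dist1 K E) : Prop :=
  (∀ v (m : Idx K), T (P v m) - P (T v) m = (-m.1) • P v (m.1 - 1, m.2)) ∧
  (∀ v (m : Idx K), Tb (P v m) - P (Tb v) m = (-m.2) • P v (m.1, m.2 - 1))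

/-- the identity field 1(z) = id_E -/
def idField : EDist1 K E :=
  fun n => if n = ((-1 : K), (-1 : K)) then (1 : Module.End K E) else 0

/-- pairs i < j in [r] -/
abbrev Pairs (r : ℕ) := {p : Fin r × Fin r // p.1 < p.2}

/-- the index shift of the i-th variable produced by the monomial of a binomial
expansion of ((𝐳_{p₁} − 𝐳_{p₂})_σ)^h belonging to 𝐤 ∈ ℕ² -/
def pairShift {r : ℕ} (p : Pairs r) (h : Idx K) (flip : Bool) (kk : ℕ × ℕ)
    (i : Fin r) : Idx K :=
  if i = p.1.1 then
    (if flip then ((kk.1 : K), (kk.2 : K)) else (h.1 - kk.1, h.2 - kk.2))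
  else if i = p.1.2 then
    (if flip then (h.1 - kk.1, h.2 - kk.2) else ((kk.1 : K), (kk.2 : K)))
  else 0

/-- the coefficient of a binomial expansion of ((𝐳_{p₁} − 𝐳_{p₂})_σ)^h
belonging to 𝐤 ∈ ℕ² -/
def pairCoef (h : Idx K) (flip : Bool) (kk : ℕ × ℕ) : K :=
  (if flip then negOnePow K (h.1 - h.2) else 1) * (-1 : K) ^ (kk.1 + kk.2) *
    gchoose K h.1 kk.1 * gchoose K h.2 kk.2

def flipOf {r : ℕ} (σ : Equiv.Perm (Fin r)) (p : Pairs r) : Bool :=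
  decide (σ.symm p.1.2 < σ.symm p.1.1)

/-- multiplication by Π_{i<j} ((𝐳_i − 𝐳_j)_σ)^{h_{ij}} on an r-variable distribution -/
def permMul {r : ℕ} (σ : Equiv.Perm (Fin r)) (hs : Pairs r → Idx K)
    (c : DistN K M r) : DistN K M r :=
  fun m => ∑ᶠ κ : Pairs r → ℕ × ℕ,
    (∏ p : Pairs r, pairCoef K (hs p) (flipOf σ p) (κ p)) •
      c (fun i => m i + ∑ p : Pairs r, pairShift K p (hs p) (flipOf σ p) (κ p) i)

/-- the Koszul sign ζ' produced by reordering a¹,…,aʳ into a^{σ1},…,a^{σr} -/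
def koszulPerm {r : ℕ} (ps : Fin r → ZMod 2) (σ : Equiv.Perm (Fin r)) : K :=
  ∏ p : Pairs r,
    if σ.symm p.1.2 < σ.symm p.1.1 ∧ ps p.1.1 = 1 ∧ ps p.1.2 = 1 then (-1 : K) else 1

/-- the composition a^{σ1}(𝐳_{σ1})_{m_{σ1}} ∘ ⋯ ∘ a^{σr}(𝐳_{σr})_{m_{σr}} applied to v -/
def compSeq {r : ℕ} (a : Fin r → EDist1 K E) (σ : Equiv.Perm (Fin r))
    (m : Fin r → Idx K) (v : E) : E :=
  (List.ofFn fun j : Fin r => σ j).foldr (fun i acc => a i (m i) acc) v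

/-- the data (c^α, 𝐡_{ij}^k) is a (multiple) OPE of the homogeneous distributions
a¹(𝐳),…,aʳ(𝐳) of parities ps -/
def IsMultOPE {r : ℕ} (a : Fin r → EDist1 K E) (ps : Fin r → ZMod 2)
    (rij : Fin r → Fin r → ℕ) (hs : ∀ i j : Fin r, Fin (rij i j) → Idx K)
    (c : ((p : Pairs r) → Fin (rij p.1.1 p.1.2)) → EDistN K E r) : Prop :=
  (∀ i j k, Kbar K (hs i j k)) ∧
  (∀ α v, InLatN K E (evN K E (c α) v)) ∧
  (∀ σ : Equiv.Perm (Fin r), ∀ v m,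
    koszulPerm K ps σ • compSeq K E a σ m v =
      ∑ α : (p : Pairs r) → Fin (rij p.1.1 p.1.2),
        permMul K E σ (fun p => -(hs p.1.1 p.1.2 (α p))) (evN K E (c α) v) m)

/-- a¹(𝐳),…,aʳ(𝐳) are multiply local -/
def MultiplyLocal {r : ℕ} (a : Fin r → EDist1 K E) (ps : Fin r → ZMod 2) : Prop :=
  ∃ (rij : Fin r → Fin r → ℕ) (hs : ∀ i j : Fin r, Fin (rij i j) → Idx K)
    (c : ((p : Pairs r) → Fin (rij p.1.1 p.1.2)) → EDistN K E r),
      IsMultOPE K E a ps rij hs c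

/-- a set of homogeneous fields (with parities pF) is multiply local -/
def MultLocalSet (F : Set (EDist1 K E)) (pF : EDist1 K E → ZMod 2) : Prop :=
  ∀ (r : ℕ) (f : Fin r → EDist1 K E), (∀ i, f i ∈ F) →
    MultiplyLocal K E f (fun i => pF (f i))

/-- a set of homogeneous fields (with parities pF) is uniformly local -/
def UnifLocalSet (F : Set (EDist1 K E)) (pF : EDist1 K E → ZMod 2) (one : E) : Prop :=
  ∃ (rr : EDist1 K E → EDist1 K E → ℕ)
    (hh : ∀ d e : EDist1 K E, Fin (rr d e) → Idx K),
    ∀ (r : ℕ) (f : Fin r → EDist1 K E), (∀ i, f i ∈ F) →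
      ∃ c, IsMultOPE K E f (fun i => pF (f i)) (fun i j => rr (f i) (f j))
          (fun i j => hh (f i) (f j)) c ∧
        ∀ α, IsPowN K E (evN K E (c α) one)

/-- a ∈ V is homogeneous of parity p w.r.t. the grading (ev, od) -/
def memPar {V : Type*} [AddCommGroup V] [Module K V] (ev od : Submodule K V)
    (a : V) (p : ZMod 2) : Prop :=
  (p = 0 ∧ a ∈ ev) ∨ (p = 1 ∧ a ∈ od)

/-- an endomorphism is homogeneous of parity p w.r.t. the grading (ev, od) -/
def EndPar {V : Type*} [AddCommGroup V] [Module K V] (ev od : Submodule K V)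
    (f : Module.End K V) (p : ZMod 2) : Prop :=
  if p = 0 then (∀ v ∈ ev, f v ∈ ev) ∧ (∀ v ∈ od, f v ∈ od)
  else (∀ v ∈ ev, f v ∈ od) ∧ (∀ v ∈ od, f v ∈ ev)

/-- a distribution is homogeneous of parity p -/
def EDistPar {V : Type*} [AddCommGroup V] [Module K V] (ev od : Submodule K V)
    (a : EDist1 K V) (p : ZMod 2) : Prop :=
  ∀ n, EndPar K ev od (a n) p

end OPEA

namespace OPEA

/-- an OPE-algebra -/
structure OPEAlg (K : Type*) [Field K] [CharZero K]
    (V : Type*) [AddCommGroup V] [Module K V] where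
  ev : Submodule K V
  od : Submodule K V
  compl : IsCompl ev od
  Y : V →ₗ[K] EDist1 K V
  Y_par : ∀ a p, memPar K ev od a p → ∀ (n : Idx K) b q, memPar K ev od b q →
    memPar K ev od (Y a n b) (p + q)
  one : V
  one_ev : one ∈ ev
  T : Module.End K V
  Tb : Module.End K V
  T_ev : EndPar K ev od T 0
  Tb_ev : EndPar K ev od Tb 0
  commTTb : T * Tb = Tb * T
  T_one : T one = 0
  Tb_one : Tb one = 0
  wcre : ∀ a, IsPow1 K V (ev1 K V (Y a) one)
  rid : ∀ a, Y a ((-1 : K), (-1 : K)) one = a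
  tcov : ∀ a, TransCov K V T Tb (Y a)
  loc : ∀ a b pa pb, memPar K ev od a pa → memPar K ev od b pb →
    IsLocal K V pa pb (Y a) (Y b)

/-- a bounded 𝕂̄-fold algebra -/
structure BFold (K : Type*) [Field K] [CharZero K]
    (V : Type*) [AddCommGroup V] [Module K V] where
  ev : Submodule K V
  od : Submodule K V
  compl : IsCompl ev od
  Y : V →ₗ[K] EDist1 K V
  Y_par : ∀ a p, memPar K ev od a p → ∀ (n : Idx K) b q, memPar K ev od b q →
    memPar K ev od (Y a n b) (p + q)
  fields : ∀ a, IsFieldD K V (Y a)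
  bounded : ∀ a (n : Idx K), ¬ Kbar K n → ∀ b, Y a n b = 0

/-- a bounded 𝕂̄-fold module over a bounded 𝕂̄-fold algebra -/
structure BMod (K : Type*) [Field K] [CharZero K]
    (V : Type*) [AddCommGroup V] [Module K V] (A : BFold K V)
    (Mo : Type*) [AddCommGroup Mo] [Module K Mo] where
  evM : Submodule K Mo
  odM : Submodule K Mo
  complM : IsCompl evM odM
  YM : V →ₗ[K] EDist1 K Mo
  YM_par : ∀ a p, memPar K A.ev A.od a p → ∀ n : Idx K, EndPar K evM odM (YM a n) p
  fieldsM : ∀ a, IsFieldD K Mo (YM a)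
  boundedM : ∀ a (n : Idx K), ¬ Kbar K n → ∀ c, YM a n c = 0

variable (K : Type*) [Field K] [CharZero K]
variable (V : Type*) [AddCommGroup V] [Module K V]
variable (Mo : Type*) [AddCommGroup Mo] [Module K Mo]

/-- the operator T₁ : a ↦ a_{(−2,−1)}1 of an OPE-algebra -/
def T1 (A : OPEAlg K V) : Module.End K V where
  toFun := fun a => A.Y a ((-2 : K), (-1 : K)) A.one
  map_add' := by
    intro x y
    simp [map_add, Pi.add_apply, LinearMap.add_apply]
  map_smul' := by
    intro c x
    simp [map_smul, Pi.smul_apply, LinearMap.smul_apply]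

/-- the operator T̄₁ : a ↦ a_{(−1,−2)}1 of an OPE-algebra -/
def T1b (A : OPEAlg K V) : Module.End K V where
  toFun := fun a => A.Y a ((-1 : K), (-2 : K)) A.one
  map_add' := by
    intro x y
    simp [map_add, Pi.add_apply, LinearMap.add_apply]
  map_smul' := by
    intro c x
    simp [map_smul, Pi.smul_apply, LinearMap.smul_apply]

/-- skew-symmetry for the pair (T, T̄) -/
def SkewSym (ev od : Submodule K V) (Yf : V → EDist1 K V)
    (T Tb : Module.End K V) : Prop :=
  ∀ a b pa pb, memPar K ev od a pa → memPar K ev od b pb →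
    ∀ n : Idx K, Kbar K n →
      (Function.support (fun i : ℕ × ℕ =>
        ((i.1.factorial : K)⁻¹ * (i.2.factorial : K)⁻¹ *
            negOnePow K (n.1 + i.1 - (n.2 + i.2))) •
          ((T ^ i.1) * (Tb ^ i.2)) (Yf a (n.1 + i.1, n.2 + i.2) b))).Finite ∧
      koszul K pa pb • Yf b n a =
        ∑ᶠ i : ℕ × ℕ, ((i.1.factorial : K)⁻¹ * (i.2.factorial : K)⁻¹ *
            negOnePow K (n.1 + i.1 - (n.2 + i.2))) •
          ((T ^ i.1) * (Tb ^ i.2)) (Yf a (n.1 + i.1, n.2 + i.2) b)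

/-- (T, T̄) is a translation endomorphism of the module with state-field map YM -/
def TransEnd (YM : V → EDist1 K Mo) (T Tb : Module.End K V) : Prop :=
  (∀ a (n : Idx K), YM (T a) n = (-n.1) • YM a (n.1 - 1, n.2)) ∧
  (∀ a (n : Idx K), YM (Tb a) n = (-n.2) • YM a (n.1, n.2 - 1))

/-- the coefficient at (x-index m, w-index k) of a(𝐱+𝐰) applied to the w-distribution bw -/
def lhsXW (YM : V → EDist1 K Mo) (a : V) (bw : Dist1 K Mo) (m k : Idx K) : Mo :=
  ∑ᶠ i : ℕ × ℕ, ((i.1.factorial : K)⁻¹ * (i.2.factorial : K)⁻¹) •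
    (((dz K (Module.End K Mo))^[i.1] ((dzb K (Module.End K Mo))^[i.2] (YM a))) m)
      (bw (k.1 + i.1, k.2 + i.2))

/-- a and cM are dual in the direct channel -/
def DualDirect (Y : V → EDist1 K V) (YM : V → EDist1 K Mo) (a : V) (cM : Mo) : Prop :=
  ∃ (s : ℕ) (d : Fin s → Idx K → Idx K → (V →ₗ[K] Mo)) (hj : Fin s → Idx K),
    (∀ j, Kbar K (hj j)) ∧
    (∀ j b, InLat2 K Mo (fun kw mx => d j kw mx b)) ∧
    (∀ b (m k : Idx K),
      lhsXW K V Mo YM a (fun k' => YM b k' cM) m k =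
        ∑ j, xwPow K Mo (-(hj j)) (fun kw mx => d j kw mx b) m k) ∧
    (∀ b (m k : Idx K),
      YM (Y a m b) k cM =
        ∑ j, wxPow K Mo (-(hj j)) (fun kw mx => d j kw mx b) m k)

/-- a and b are dual in the exchange channel on the module -/
def DualExch (Y : V → EDist1 K V) (YM : V → EDist1 K Mo) (a b : V) : Prop :=
  ∃ (r : ℕ) (hab : Fin r → Idx K), (∀ i, Kbar K (hab i)) ∧
    ∀ cM : Mo, ∃ (s : ℕ) (hac : Fin s → Idx K)
      (q : Fin r → Fin s → Idx K → Idx K → Mo),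
      (∀ j, Kbar K (hac j)) ∧
      (∀ i j kw mx, q i j kw mx ≠ 0 → IsNegInt K mx.1 ∧ IsNegInt K mx.2) ∧
      (∀ i j mx, InLat1 K Mo (fun kw => q i j kw mx)) ∧
      (∀ m k : Idx K,
        lhsXW K V Mo YM a (fun k' => YM b k' cM) m k =
          ∑ j, xwPow K Mo (-(hac j))
            (fun kw mx => ∑ i, q i j kw (mx.1 - (hab i).1, mx.2 - (hab i).2)) m k) ∧
      (∀ m k : Idx K,
        YM (Y a m b) k cM =
          ∑ j, wxPow K Mo (-(hac j))
            (fun kw mx => ∑ i, q i j kw (mx.1 - (hab i).1, mx.2 - (hab i).2)) m k)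

/-- the module with state-field map YM is dual -/
def IsDualMod (ev od : Submodule K V) (Y : V → EDist1 K V) (YM : V → EDist1 K Mo) : Prop :=
  ∃ (rVV : V → V → ℕ) (hVV : ∀ a b : V, Fin (rVV a b) → Idx K)
    (rVM : V → Mo → ℕ) (hVM : ∀ (a : V) (c : Mo), Fin (rVM a c) → Idx K),
    (∀ a b i, Kbar K (hVV a b i)) ∧ (∀ a c j, Kbar K (hVM a c j)) ∧
    ∀ a b pa pb, memPar K ev od a pa → memPar K ev od b pb → ∀ c : Mo,
      ∃ p : Fin (rVV a b) → Fin (rVM a c) → Fin (rVM b c) → Dist2 K Mo,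
        (∀ i j k, IsPow2 K Mo (p i j k)) ∧
        (∀ m k : Idx K,
          lhsXW K V Mo YM a (fun k' => YM b k' c) m k =
            ∑ i, ∑ j, ∑ kk, tripleXW K Mo (-(hVV a b i)) (-(hVM b c kk))
              (-(hVM a c j)) (p i j kk) m k) ∧
        (∀ m k : Idx K,
          YM (Y a m b) k c =
            ∑ i, ∑ j, ∑ kk, tripleWX K Mo (-(hVV a b i)) (-(hVM b c kk))
              (-(hVM a c j)) (p i j kk) m k)

/-- F_Y is multiply local -/
def MultLocalAlg (A : OPEAlg K V) : Prop :=
  ∀ (r : ℕ) (f : Fin r → V) (pf : Fin r → ZMod 2),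
    (∀ i, memPar K A.ev A.od (f i) (pf i)) →
      MultiplyLocal K V (fun i => A.Y (f i)) pf

/-- F_Y is uniformly local -/
def UnifLocalAlg (A : OPEAlg K V) : Prop :=
  ∃ (rr : V → V → ℕ) (hh : ∀ a b : V, Fin (rr a b) → Idx K),
    ∀ (r : ℕ) (f : Fin r → V) (pf : Fin r → ZMod 2),
      (∀ i, memPar K A.ev A.od (f i) (pf i)) →
        ∃ c, IsMultOPE K V (fun i => A.Y (f i)) pf (fun i j => rr (f i) (f j))
            (fun i j => hh (f i) (f j)) c ∧
          ∀ α, IsPowN K V (evN K V (c α) A.one)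

end OPEA
namespace OPEA

set_option linter.unusedSectionVars false

section Binomial

variable {K : Type*} [Field K] [CharZero K]

lemma gchoose_zero_right (x : K) : gchoose K x 0 = 1 := by simp [gchoose]

lemma gchoose_succ_mul (x : K) (k : ℕ) :
    gchoose K x (k + 1) * (k + 1) = gchoose K x k * (x - k) := by
  have h1 : ((k.factorial : ℕ) : K) ≠ 0 := by exact_mod_cast k.factorial_ne_zero
  have h2 : ((k : K) + 1) ≠ 0 := by exact_mod_cast k.succ_ne_zero
  simp only [gchoose, Finset.prod_range_succ, Nat.factorial_succ]
  push_cast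
  field_simp

lemma gchoose_succ_mul' (x : K) (k : ℕ) :
    gchoose K x (k + 1) * (k + 1) = x * gchoose K (x - 1) k := by
  have h1 : ((k.factorial : ℕ) : K) ≠ 0 := by exact_mod_cast k.factorial_ne_zero
  have h2 : ((k : K) + 1) ≠ 0 := by exact_mod_cast k.succ_ne_zero
  have h3 : ∏ i ∈ Finset.range k, (x - ((i + 1 : ℕ) : K)) =
      ∏ i ∈ Finset.range k, (x - 1 - (i : K)) :=
    Finset.prod_congr rfl fun i _ => by push_cast; ring
  simp only [gchoose, Finset.prod_range_succ', Nat.factorial_succ, h3]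
  push_cast
  field_simp
  ring

lemma gchoose_eq_choose (x : K) (k : ℕ) : gchoose K x k = Ring.choose x k := by
  rw [Ring.choose_eq_smul, ← Polynomial.aeval_eq_smeval, Polynomial.aeval_def,
    ← Polynomial.eval_map, descPochhammer_map, descPochhammer_eval_eq_prod_range, gchoose,
    smul_eq_mul, div_eq_inv_mul]

lemma gchoose_add (x y : K) (n : ℕ) :
    gchoose K (x + y) n =
      ∑ p ∈ Finset.HasAntidiagonal.antidiagonal n, gchoose K x p.1 * gchoose K y p.2 := by
  simp only [gchoose_eq_choose]
  exact Ring.add_choose_eq n (Commute.all x y)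

lemma gchoose_pascal (x : K) (k : ℕ) :
    gchoose K (x + 1) (k + 1) = gchoose K x k + gchoose K x (k + 1) := by
  simp only [gchoose_eq_choose]
  exact Ring.choose_succ_succ x k

/-- the coefficient of `wᵏ` in `(1 - w)^x` -/
def binCoef (x : K) (k : ℕ) : K := (-1) ^ k * gchoose K x k

lemma binCoef_zero_right (x : K) : binCoef x 0 = 1 := by simp [binCoef, gchoose_zero_right]

lemma binCoef_add (x y : K) (n : ℕ) :
    binCoef (x + y) n =
      ∑ p ∈ Finset.HasAntidiagonal.antidiagonal n, binCoef x p.1 * binCoef y p.2 := by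
  rw [binCoef, gchoose_add, Finset.mul_sum]
  refine Finset.sum_congr rfl fun p hp => ?_
  rw [Finset.HasAntidiagonal.mem_antidiagonal] at hp
  rw [binCoef, binCoef, ← hp, pow_add]
  ring

lemma binCoef_succ_mul (x : K) (k : ℕ) :
    binCoef x (k + 1) * ((k + 1 : ℕ) : K) = -x * binCoef (x - 1) k := by
  have := gchoose_succ_mul' x k
  rw [binCoef, binCoef, pow_succ]
  push_cast
  linear_combination (-(-1) ^ k) * this

lemma binCoef_mul_sub (x : K) (k : ℕ) :
    binCoef x k * (x - k) = x * binCoef (x - 1) k := by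
  have h1 := gchoose_succ_mul x k
  have h2 := gchoose_succ_mul' x k
  rw [binCoef, binCoef]
  linear_combination (-1) ^ k * (h2 - h1)

lemma binCoef_pascal (x : K) (k : ℕ) :
    binCoef (x + 1) (k + 1) = binCoef x (k + 1) - binCoef x k := by
  simp only [binCoef, gchoose_pascal, pow_succ]
  ring

/-- extension by zero of a function on `ℕ` to `K` -/
def natExt (f : ℕ → K) (z : K) : K := if hz : ∃ l : ℕ, (l : K) = z then f hz.choose else 0

lemma natExt_natCast (f : ℕ → K) (l : ℕ) : natExt f (l : K) = f l := by
  have hz : ∃ m : ℕ, (m : K) = (l : K) := ⟨l, rfl⟩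
  rw [natExt, dif_pos hz]
  congr 1
  exact_mod_cast hz.choose_spec

lemma natExt_of_not {f : ℕ → K} {z : K} (hz : ¬ ∃ l : ℕ, (l : K) = z) : natExt f z = 0 :=
  dif_neg hz

lemma natExt_rec (f g : ℕ → K) (e : K) (h0 : f 0 = g 0)
    (h : ∀ l, f (l + 1) = g (l + 1) + e * g l) (z : K) :
    natExt f z = natExt g z + e * natExt g (z - 1) := by
  by_cases hz : ∃ l : ℕ, (l : K) = z
  · obtain ⟨l, rfl⟩ := hz
    cases l with
    | zero =>
      rw [natExt_natCast, natExt_natCast, natExt_of_not (z := ((0 : ℕ) : K) - 1), mul_zero,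
        add_zero, h0]
      rintro ⟨l, hl⟩
      have : ((l + 1 : ℕ) : K) = 0 := by push_cast at hl ⊢; rw [hl]; ring
      exact Nat.succ_ne_zero l (by exact_mod_cast this)
    | succ l =>
      have : ((l + 1 : ℕ) : K) - 1 = (l : K) := by push_cast; ring
      rw [this, natExt_natCast, natExt_natCast, natExt_natCast, h]
  · rw [natExt_of_not hz, natExt_of_not hz, natExt_of_not, mul_zero, add_zero]
    rintro ⟨l, hl⟩
    exact hz ⟨l + 1, by push_cast; rw [hl]; ring⟩

end Binomial

section Independence

variable {K : Type*} [Field K] [CharZero K] {E : Type*} [AddCommGroup E] [Module K E]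

lemma sum_fiber_eq_zero_of_gchoose {T : Type*} (S : Finset T) (x : T → K) (f : T → E)
    (hf : ∀ l, ∑ t ∈ S, gchoose K (x t) l • f t = 0) (z : K) :
    ∑ t ∈ S with x t = z, f t = 0 := by
  have key : ∀ (A : Finset K) (l : ℕ),
      ∑ t ∈ S, ((∏ a ∈ A, (x t - a)) * gchoose K (x t) l) • f t = 0 := by
    intro A
    induction A using Finset.induction_on with
    | empty => simpa using hf
    | insert a A ha ih =>
      intro l
      have h1 : ∀ t, ((∏ a ∈ insert a A, (x t - a)) * gchoose K (x t) l) • f t =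
          ((l : K) + 1) • (((∏ a ∈ A, (x t - a)) * gchoose K (x t) (l + 1)) • f t) +
          ((l : K) - a) • (((∏ a ∈ A, (x t - a)) * gchoose K (x t) l) • f t) := by
        intro t
        rw [smul_smul, smul_smul, ← add_smul, Finset.prod_insert ha]
        congr 1
        linear_combination (-(∏ a ∈ A, (x t - a))) * gchoose_succ_mul (x t) l
      simp only [h1]
      rw [Finset.sum_add_distrib, ← Finset.smul_sum, ← Finset.smul_sum, ih, ih]
      simp
  have h2 := key ((S.image x).erase z) 0
  simp only [gchoose_zero_right, mul_one] at h2
  have h3 : ∏ a ∈ (S.image x).erase z, (z - a) ≠ 0 :=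
    Finset.prod_ne_zero_iff.2 fun a ha => sub_ne_zero.2 (Finset.ne_of_mem_erase ha).symm
  rw [← smul_eq_zero_iff_right h3, Finset.smul_sum, ← h2, Finset.sum_filter]
  refine Finset.sum_congr rfl fun t ht => ?_
  split_ifs with hx
  · rw [hx]
  · rw [Finset.prod_eq_zero (i := x t), zero_smul]
    · exact Finset.mem_erase.2 ⟨hx, Finset.mem_image_of_mem x ht⟩
    · exact sub_self _

lemma sum_fiber_eq_zero_of_gchoose₂ {T : Type*} (S : Finset T) (x : T → Idx K) (f : T → E)
    (hf : ∀ l l', ∑ t ∈ S, (gchoose K (x t).1 l * gchoose K (x t).2 l') • f t = 0) (z : Idx K) :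
    ∑ t ∈ S with x t = z, f t = 0 := by
  have h1 := sum_fiber_eq_zero_of_gchoose (S.filter fun t => (x t).1 = z.1) (fun t => (x t).2) f
    (fun l' => by
      refine sum_fiber_eq_zero_of_gchoose S (fun t => (x t).1)
        (fun t => gchoose K (x t).2 l' • f t) (fun l => ?_) z.1
      simpa only [smul_smul] using hf l l') z.2
  rw [Finset.filter_filter] at h1
  simpa only [Prod.ext_iff] using h1

/-- the coefficient of `w^{-k}` in `w^{-y} (1 - w)^{-h}` -/
def binFun (y h k : K) : K := natExt (binCoef (-h)) (y - k)

lemma binFun_rec (y h k : K) : binFun y h k = binFun y (h + 1) k - binFun (y - 1) (h + 1) k := by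
  rw [binFun, binFun, binFun, show y - 1 - k = y - k - 1 by ring]
  rw [natExt_rec (binCoef (-h)) (binCoef (-(h + 1))) (-1) (by simp [binCoef_zero_right])
    (fun l => ?_)]
  · ring
  · rw [show -h = -(h + 1) + 1 by ring, binCoef_pascal]
    ring

lemma sum_eq_zero_of_binFun_of_rep {T : Type*} [Fintype T] (y h : T → Idx K) (f : T → E)
    (hy : ∀ s t, IsIntPair K (y s - y t) → y s = y t)
    (hf : ∀ k : Idx K,
      ∑ t, (binFun (y t).1 (h t).1 k.1 * binFun (y t).2 (h t).2 k.2) • f t = 0)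
    (g : Idx K → Idx K → K) : ∑ t, g (y t) (h t) • f t = 0 := by
  have h1 : ∀ u z : Idx K, ∑ t with y t = u ∧ -(h t) = z, f t = 0 := by
    intro u z
    rw [← Finset.filter_filter]
    by_cases hu : ∃ s, y s = u
    swap
    · push Not at hu
      rw [Finset.filter_false_of_mem fun t _ => hu t]
      simp
    obtain ⟨s, rfl⟩ := hu
    refine sum_fiber_eq_zero_of_gchoose₂ _ (fun t => -(h t)) f (fun l l' => ?_) z
    have h2 := hf ((y s).1 - l, (y s).2 - l')
    rw [Finset.sum_filter]
    have h3 : ((-1 : K) ^ l * (-1) ^ l') ≠ 0 := by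
      rw [← pow_add]; exact pow_ne_zero _ (neg_ne_zero.2 one_ne_zero)
    rw [← smul_eq_zero_iff_right h3, Finset.smul_sum]
    refine Eq.trans (Finset.sum_congr rfl fun t _ => ?_) h2
    split_ifs with ht
    · rw [ht]
      simp only [binFun, sub_sub_cancel, natExt_natCast, smul_smul, binCoef, Prod.fst_neg,
        Prod.snd_neg]
      congr 1
      ring
    · symm
      rw [smul_zero]
      convert zero_smul K (f t)
      by_contra h4
      rw [mul_eq_zero, not_or] at h4
      refine ht (hy t s ⟨?_, ?_⟩)
      · obtain ⟨m, hm⟩ := not_imp_comm.1 natExt_of_not h4.1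
        exact ⟨m - l, by push_cast; rw [hm]; simp only [Prod.fst_sub]; ring⟩
      · obtain ⟨m, hm⟩ := not_imp_comm.1 natExt_of_not h4.2
        exact ⟨m - l', by push_cast; rw [hm]; simp only [Prod.snd_sub]; ring⟩
  rw [← Finset.sum_fiberwise_of_maps_to (s := Finset.univ)
    (t := Finset.univ.image fun t => (y t, -(h t))) (g := fun t => (y t, -(h t)))
    (fun t _ => Finset.mem_image_of_mem _ (Finset.mem_univ t))]
  refine Finset.sum_eq_zero fun q _ => ?_
  have h5 := congrArg (fun e => g q.1 (-q.2) • e) (h1 q.1 q.2)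
  simp only [smul_zero, Finset.smul_sum] at h5
  rw [← h5]
  refine Finset.sum_congr (by ext t; simp [Prod.ext_iff]) fun t ht => ?_
  simp only [Finset.mem_filter, Finset.mem_univ, true_and] at ht
  rw [← ht.1, ← ht.2, neg_neg]

lemma sub_nat_expand (g : K → K → K) (hg : ∀ y h, g y h = g y (h + 1) - g (y - 1) (h + 1))
    (N : ℕ) : ∀ y h, g (y - N) h =
      ∑ l ∈ Finset.range (N + 1), ((-1) ^ l * (N.choose l : K)) * g y (h - l) := by
  induction N with
  | zero => intro y h; simp
  | succ N ih =>
    intro y h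
    have h1 : ∀ y h, g (y - 1) h = g y h - g y (h - 1) := by
      intro y h
      have := hg y (h - 1)
      rw [sub_add_cancel] at this
      rw [this]; ring
    have h2 : y - ((N + 1 : ℕ) : K) = y - 1 - N := by push_cast; ring
    rw [h2, ih, Finset.sum_range_succ' _ (N + 1)]
    simp only [h1, mul_sub, Finset.sum_sub_distrib]
    have h3 : ∀ l : ℕ, (-1 : K) ^ (l + 1) * ((N + 1).choose (l + 1) : K) * g y (h - (l + 1 : ℕ)) =
        (-1 : K) ^ (l + 1) * (N.choose (l + 1) : K) * g y (h - (l + 1 : ℕ)) -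
        (-1 : K) ^ l * (N.choose l : K) * g y (h - l - 1) := by
      intro l
      rw [Nat.choose_succ_succ, show h - (l : K) - 1 = h - (l + 1 : ℕ) by push_cast; ring]
      push_cast
      ring
    simp only [h3, Finset.sum_sub_distrib]
    have h4 := Finset.sum_range_succ'
      (fun l : ℕ => (-1 : K) ^ l * (N.choose l : K) * g y (h - l)) (N + 1)
    rw [Finset.sum_range_succ] at h4
    simp only [Nat.choose_succ_self, Nat.cast_zero, mul_zero, zero_mul, add_zero] at h4
    rw [h4]
    simp only [Nat.choose_zero_right, Nat.cast_zero]
    ring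

lemma exists_class_bound (S : Finset K) : ∃ ρ : K → K,
    (∀ x ∈ S, ∃ N : ℕ, x = ρ x - N) ∧ ∀ x y, IsInt K (ρ x - ρ y) → ρ x = ρ y := by
  let H : AddSubgroup K := (Int.castAddHom K).range
  have h1 : ∀ x : K, ∃ z : ℤ, x = (QuotientAddGroup.mk x : K ⧸ H).out + z := by
    intro x
    have : (QuotientAddGroup.mk (QuotientAddGroup.mk x : K ⧸ H).out : K ⧸ H) =
      QuotientAddGroup.mk x := Quotient.out_eq _
    obtain ⟨z, hz⟩ := QuotientAddGroup.eq.1 this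
    exact ⟨z, by simp only [Int.coe_castAddHom] at hz; rw [hz]; ring⟩
  choose z hz using h1
  let M : ℕ := ∑ x ∈ S, (z x).natAbs
  refine ⟨fun x => (QuotientAddGroup.mk x : K ⧸ H).out + M, fun x hx => ?_, fun x y hxy => ?_⟩
  · have h2 : (z x).natAbs ≤ M :=
      Finset.single_le_sum (f := fun x => (z x).natAbs) (fun _ _ => Nat.zero_le _) hx
    obtain ⟨N, hN⟩ := Int.eq_ofNat_of_zero_le (show 0 ≤ (M : ℤ) - z x by omega)
    refine ⟨N, ?_⟩
    have h3 : (N : K) = (M : K) - (z x : K) := by exact_mod_cast hN.symm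
    rw [h3]
    nth_rw 1 [hz x]
    ring
  · obtain ⟨k, hk⟩ := hxy
    have h4 : (QuotientAddGroup.mk x : K ⧸ H) = QuotientAddGroup.mk y := by
      rw [← Quotient.out_eq (QuotientAddGroup.mk x : K ⧸ H),
        ← Quotient.out_eq (QuotientAddGroup.mk y : K ⧸ H)]
      refine QuotientAddGroup.eq.2 ⟨-k, ?_⟩
      simp only [Int.coe_castAddHom, Int.cast_neg, hk]
      ring
    simp only [h4]

lemma sum_eq_zero_of_binFun {T : Type*} [Fintype T] (y h : T → Idx K) (f : T → E)
    (hf : ∀ k : Idx K,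
      ∑ t, (binFun (y t).1 (h t).1 k.1 * binFun (y t).2 (h t).2 k.2) • f t = 0)
    (g g' : K → K → K) (hg : ∀ y h, g y h = g y (h + 1) - g (y - 1) (h + 1))
    (hg' : ∀ y h, g' y h = g' y (h + 1) - g' (y - 1) (h + 1)) :
    ∑ t, (g (y t).1 (h t).1 * g' (y t).2 (h t).2) • f t = 0 := by
  obtain ⟨ρ, hρ, hρ'⟩ := exists_class_bound (Finset.univ.image fun t => (y t).1)
  obtain ⟨τ, hτ, hτ'⟩ := exists_class_bound (Finset.univ.image fun t => (y t).2)
  have h1 : ∀ t, ∃ N : ℕ, (y t).1 = ρ (y t).1 - N := fun t =>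
    hρ _ (Finset.mem_image_of_mem _ (Finset.mem_univ t))
  have h2 : ∀ t, ∃ N : ℕ, (y t).2 = τ (y t).2 - N := fun t =>
    hτ _ (Finset.mem_image_of_mem _ (Finset.mem_univ t))
  choose N hN using h1
  choose N' hN' using h2
  have key : ∀ (g g' : K → K → K) (_ : ∀ y h, g y h = g y (h + 1) - g (y - 1) (h + 1))
      (_ : ∀ y h, g' y h = g' y (h + 1) - g' (y - 1) (h + 1)),
      ∑ t, (g (y t).1 (h t).1 * g' (y t).2 (h t).2) • f t =
      ∑ u : (t : T) × (Fin (N t + 1) × Fin (N' t + 1)),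
        (g (ρ (y u.1).1) ((h u.1).1 - (u.2.1 : ℕ)) * g' (τ (y u.1).2) ((h u.1).2 - (u.2.2 : ℕ))) •
        (((-1) ^ (u.2.1 : ℕ) * ((N u.1).choose u.2.1 : K)) *
          ((-1) ^ (u.2.2 : ℕ) * ((N' u.1).choose u.2.2 : K))) • f u.1 := by
    intro g g' hg hg'
    rw [Fintype.sum_sigma]
    refine Finset.sum_congr rfl fun t _ => ?_
    conv_lhs => rw [hN t, hN' t, sub_nat_expand g hg, sub_nat_expand g' hg']
    rw [Finset.sum_mul_sum, Finset.sum_smul, Fintype.sum_prod_type, Finset.sum_range]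
    refine Finset.sum_congr rfl fun l _ => ?_
    rw [Finset.sum_smul, Finset.sum_range]
    refine Finset.sum_congr rfl fun l' _ => ?_
    rw [smul_smul]
    congr 1
    ring
  rw [key g g' hg hg']
  refine sum_eq_zero_of_binFun_of_rep
    (fun u : (t : T) × (Fin (N t + 1) × Fin (N' t + 1)) => (ρ (y u.1).1, τ (y u.1).2))
    (fun u => ((h u.1).1 - (u.2.1 : ℕ), (h u.1).2 - (u.2.2 : ℕ))) _ ?_ ?_
    (fun y h => g y.1 h.1 * g' y.2 h.2)
  · intro u v huv
    exact Prod.ext (hρ' _ _ huv.1) (hτ' _ _ huv.2)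
  · intro k
    rw [← hf k, key (fun y h => binFun y h k.1) (fun y h => binFun y h k.2)
      (fun y h => binFun_rec y h k.1) (fun y h => binFun_rec y h k.2)]

end Independence

section Uniqueness

lemma finsum_comp_of_injective {α β M : Type*} [AddCommMonoid M] {g : α → β}
    (hg : Function.Injective g) (f : β → M) (hf : ∀ x, f x ≠ 0 → ∃ i, g i = x) :
    ∑ᶠ i, f (g i) = ∑ᶠ x, f x := by
  rw [← finsum_mem_range hg, ← finsum_mem_univ f]
  refine finsum_mem_inter_support_eq' _ _ _ fun x hx => ?_
  simpa using hf x hx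

variable {K : Type*} [Field K] [CharZero K] {E : Type*} [AddCommGroup E] [Module K E]

lemma isNegInt_iff {x : K} : IsNegInt K x ↔ ∃ t : ℕ, x = -((t : K) + 1) := by
  constructor
  · rintro ⟨k, hk, rfl⟩
    obtain ⟨t, ht⟩ := Int.eq_ofNat_of_zero_le (show 0 ≤ -k - 1 by omega)
    refine ⟨t, ?_⟩
    have : k = -((t : ℤ) + 1) := by omega
    rw [this]
    push_cast
    ring
  · rintro ⟨t, rfl⟩
    exact ⟨-((t : ℤ) + 1), by omega, by push_cast; ring⟩

lemma finite_setOf_isNegInt (a b s : K) :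
    {x : K | IsNegInt K (x - a) ∧ IsNegInt K (s - x - b)}.Finite := by
  by_cases hN : ∃ N : ℕ, (N : K) = a + b - s - 2
  · obtain ⟨N, hN⟩ := hN
    refine ((Finset.range (N + 1)).image fun t : ℕ => a - (t + 1)).finite_toSet.subset ?_
    rintro x ⟨hx, hx'⟩
    obtain ⟨t, ht⟩ := isNegInt_iff.1 hx
    obtain ⟨t', ht'⟩ := isNegInt_iff.1 hx'
    have h1 : ((t + t' : ℕ) : K) = N := by
      push_cast
      linear_combination -hN + ht + ht'
    have h2 : t + t' = N := by exact_mod_cast h1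
    simp only [Finset.coe_image, Set.mem_image, Finset.coe_range, Set.mem_Iio]
    exact ⟨t, by omega, by linear_combination -ht⟩
  · convert Set.finite_empty
    refine Set.eq_empty_iff_forall_notMem.2 ?_
    rintro x ⟨hx, hx'⟩
    obtain ⟨t, ht⟩ := isNegInt_iff.1 hx
    obtain ⟨t', ht'⟩ := isNegInt_iff.1 hx'
    exact hN ⟨t + t', by push_cast; linear_combination ht + ht'⟩

lemma InLat2.finite_antidiagonal {c : Dist2 K E} (hc : InLat2 K E c) (s : Idx K) :
    {y : Idx K | c (s - y) y ≠ 0}.Finite := by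
  obtain ⟨S, hS⟩ := hc
  refine (Set.Finite.biUnion S.finite_toSet fun m _ =>
    (finite_setOf_isNegInt m.2.1 m.1.1 s.1).prod (finite_setOf_isNegInt m.2.2 m.1.2 s.2)).subset ?_
  intro y hy
  obtain ⟨m, hm, h⟩ := hS _ _ hy
  simp only [Set.mem_iUnion, Set.mem_prod, Set.mem_ofPred_eq]
  exact ⟨m, hm, ⟨h.2.1, h.1.1⟩, h.2.2, h.1.2⟩

lemma dPow_natCast {A : Type*} [AddCommGroup A] [Module K A] (d : A → A) (j : ℕ) (a : A) :
    dPow K d (j : K) a = ((j.factorial : K))⁻¹ • d^[j] a := by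
  have h : ∃ l : ℕ, (l : K) = (j : K) := ⟨j, rfl⟩
  have h' : h.choose = j := by exact_mod_cast h.choose_spec
  rw [dPow, dif_pos h, h']

lemma iterate_d1z (j : ℕ) (c : Dist2 K E) (x y : Idx K) :
    (d1z K E)^[j] c x y = (∏ i ∈ Finset.range j, ((i : K) - x.1)) • c (x.1 - j, x.2) y := by
  induction j generalizing x with
  | zero => simp
  | succ j ih =>
    rw [Function.iterate_succ_apply', d1z, ih, smul_smul, Finset.prod_range_succ']
    congr 1
    · rw [mul_comm]
      congr 1
      · exact Finset.prod_congr rfl fun i _ => by push_cast; ring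
      · simp
    · rw [show x.1 - 1 - (j : K) = x.1 - (j + 1 : ℕ) by push_cast; ring]

lemma iterate_d1zb (j : ℕ) (c : Dist2 K E) (x y : Idx K) :
    (d1zb K E)^[j] c x y = (∏ i ∈ Finset.range j, ((i : K) - x.2)) • c (x.1, x.2 - j) y := by
  induction j generalizing x with
  | zero => simp
  | succ j ih =>
    rw [Function.iterate_succ_apply', d1zb, ih, smul_smul, Finset.prod_range_succ']
    congr 1
    · rw [mul_comm]
      congr 1
      · exact Finset.prod_congr rfl fun i _ => by push_cast; ring
      · simp
    · rw [show x.2 - 1 - (j : K) = x.2 - (j + 1 : ℕ) by push_cast; ring]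

lemma prod_range_sub_eq_gchoose (j : ℕ) (x : K) :
    (j.factorial : K)⁻¹ * ∏ i ∈ Finset.range j, ((i : K) - x) = gchoose K (j - 1 - x) j := by
  rw [gchoose, div_eq_inv_mul, ← Finset.prod_range_reflect]
  congr 1
  refine Finset.prod_congr rfl fun i hi => ?_
  have : i < j := Finset.mem_range.1 hi
  rw [Nat.cast_sub (by omega), Nat.cast_sub (by omega)]
  push_cast
  ring

lemma dPow_d1z (e : K) (c : Dist2 K E) (x y : Idx K) :
    dPow K (d1z K E) e c x y =
      natExt (fun j => gchoose K (e - 1 - x.1) j) e • c (x.1 - e, x.2) y := by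
  by_cases he : ∃ j : ℕ, (j : K) = e
  · obtain ⟨j, rfl⟩ := he
    rw [dPow_natCast, natExt_natCast, ← prod_range_sub_eq_gchoose, ← smul_smul, ← iterate_d1z]
    rfl
  · rw [dPow, dif_neg he, natExt_of_not he, zero_smul]
    rfl

lemma dPow_d1zb (e : K) (c : Dist2 K E) (x y : Idx K) :
    dPow K (d1zb K E) e c x y =
      natExt (fun j => gchoose K (e - 1 - x.2) j) e • c (x.1, x.2 - e) y := by
  by_cases he : ∃ j : ℕ, (j : K) = e
  · obtain ⟨j, rfl⟩ := he
    rw [dPow_natCast, natExt_natCast, ← prod_range_sub_eq_gchoose, ← smul_smul, ← iterate_d1zb]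
    rfl
  · rw [dPow, dif_neg he, natExt_of_not he, zero_smul]
    rfl

/-- the coefficient at `w^{-y}` of `∂_z^{(h-1-n)}` acting on `z^{y+h-D}`, as a function of `y`
and `h` -/
def derivFun (D n y h : K) : K := natExt (gchoose K (y + h - 1 - D)) (h - 1 - n)

lemma derivFun_rec (D n y h : K) :
    derivFun D n y h = derivFun D n y (h + 1) - derivFun D n (y - 1) (h + 1) := by
  rw [derivFun, derivFun, derivFun, natExt_rec (gchoose K (y + (h + 1) - 1 - D))
    (gchoose K (y - 1 + (h + 1) - 1 - D)) 1 (by simp [gchoose_zero_right]) (fun l => ?_)]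
  · rw [show y - 1 + (h + 1) - 1 - D = y + h - 1 - D by ring,
      show h + 1 - 1 - n - 1 = h - 1 - n by ring]
    ring
  · rw [show y + (h + 1) - 1 - D = (y - 1 + (h + 1) - 1 - D) + 1 by ring, gchoose_pascal]
    ring

lemma ddPow2_apply (D n : Idx K) (h : Idx K) (c : Dist2 K E) (y : Idx K) :
    ddPow2 K E (h.1 - 1 - n.1, h.2 - 1 - n.2) c
        (D.1 - n.1 - y.1 - 1, D.2 - n.2 - y.2 - 1) y =
      (derivFun D.1 n.1 y.1 h.1 * derivFun D.2 n.2 y.2 h.2) • c (D - h - y) y := by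
  rw [ddPow2, dPow_d1z, dPow_d1zb, smul_smul, derivFun, derivFun]
  dsimp only
  congr 1
  · congr 2 <;> funext j <;> congr 1 <;> ring
  · congr 1
    ext <;> simp <;> ring

lemma diag_ddPow2 {c : Dist2 K E} (hc : InLat2 K E c) (D n h : Idx K) :
    diag K E (ddPow2 K E (h.1 - 1 - n.1, h.2 - 1 - n.2) c) (D - n) =
      ∑ y ∈ (hc.finite_antidiagonal (D - h)).toFinset,
        (derivFun D.1 n.1 y.1 h.1 * derivFun D.2 n.2 y.2 h.2) • c (D - h - y) y := by
  let e : Idx K → Idx K := fun y => (D.1 - n.1 - y.1 - 1, D.2 - n.2 - y.2 - 1)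
  have he : Function.Bijective e := by
    refine Function.Involutive.bijective fun y => ?_
    ext <;> simp only [e] <;> ring
  rw [diag, ← finsum_comp e he]
  have : ∀ y : Idx K, ((D - n).1 - (e y).1 - 1, (D - n).2 - (e y).2 - 1) = y := by
    intro y
    ext <;> simp only [e, Prod.fst_sub, Prod.snd_sub] <;> ring
  simp only [this]
  rw [← finsum_eq_sum_of_support_subset]
  · exact finsum_congr fun y => ddPow2_apply D n h c y
  · intro y hy
    simp only [Set.Finite.coe_toFinset]
    exact right_ne_zero_of_smul hy

lemma finsum_natExt_smul (f : Idx K → E) (S : Finset (Idx K)) (hS : ∀ y, f y ≠ 0 → y ∈ S)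
    (φ ψ : ℕ → K) (k : Idx K) :
    ∑ᶠ l : ℕ × ℕ, (φ l.1 * ψ l.2) • f (k.1 + l.1, k.2 + l.2) =
      ∑ y ∈ S, (natExt φ (y.1 - k.1) * natExt ψ (y.2 - k.2)) • f y := by
  rw [← finsum_eq_sum_of_support_subset _ (s := S) (fun y hy => hS y (right_ne_zero_of_smul hy)),
    ← finsum_comp_of_injective (g := fun l : ℕ × ℕ => ((k.1 + l.1, k.2 + l.2) : Idx K))]
  · simp only [add_sub_cancel_left, natExt_natCast]
  · intro l l' hl
    simp only [Prod.mk.injEq, add_right_inj, Nat.cast_inj] at hl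
    exact Prod.ext hl.1 hl.2
  · intro y hy
    have h1 := left_ne_zero_of_smul hy
    obtain ⟨l, hl⟩ := not_imp_comm.1 natExt_of_not (left_ne_zero_of_mul h1)
    obtain ⟨l', hl'⟩ := not_imp_comm.1 natExt_of_not (right_ne_zero_of_mul h1)
    exact ⟨(l, l'), by ext <;> simp [hl, hl']⟩

lemma zwPow_antidiagonal {c : Dist2 K E} (hc : InLat2 K E c) (D h k : Idx K) :
    zwPow K E (-h) c (D - k) k =
      ∑ y ∈ (hc.finite_antidiagonal (D - h)).toFinset,
        (binFun y.1 h.1 k.1 * binFun y.2 h.2 k.2) • c (D - h - y) y := by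
  unfold binFun
  rw [zwPow, ← finsum_natExt_smul (fun y => c (D - h - y) y) _ (by simp)]
  refine finsum_congr fun l => ?_
  congr 1
  · simp only [binCoef, pow_add, Prod.fst_neg, Prod.snd_neg]
    ring
  · congr 1
    ext <;> simp <;> ring

/-- a relation `∑ (z - w)^{-h i} c i = 0` determines all its residue products -/
lemma sum_diag_eq_zero_of_sum_zwPow_eq_zero {ι : Type*} [Fintype ι] (c : ι → Dist2 K E)
    (hc : ∀ i, InLat2 K E (c i)) (h : ι → Idx K)
    (h0 : ∀ m k, ∑ i, zwPow K E (-(h i)) (c i) m k = 0) (n m : Idx K) :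
    ∑ i, diag K E (ddPow2 K E ((h i).1 - 1 - n.1, (h i).2 - 1 - n.2) (c i)) m = 0 := by
  obtain ⟨D, rfl⟩ : ∃ D, m = D - n := ⟨m + n, by simp⟩
  simp only [diag_ddPow2 (hc _)]
  have key := sum_eq_zero_of_binFun
    (T := (i : ι) × ((hc i).finite_antidiagonal (D - h i)).toFinset)
    (fun t => t.2.1) (fun t => h t.1) (fun t => c t.1 (D - h t.1 - t.2.1) t.2.1) (fun k => ?_)
    (derivFun D.1 n.1) (derivFun D.2 n.2) (derivFun_rec _ _) (derivFun_rec _ _)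
  · refine Eq.trans ?_ key
    rw [Fintype.sum_sigma]
    exact Finset.sum_congr rfl fun i _ => (Finset.sum_coe_sort _ fun y =>
      (derivFun D.1 n.1 y.1 (h i).1 * derivFun D.2 n.2 y.2 (h i).2) • c i (D - h i - y) y).symm
  · refine Eq.trans ?_ (h0 (D - k) k)
    rw [Fintype.sum_sigma]
    refine Finset.sum_congr rfl fun i _ => ?_
    rw [zwPow_antidiagonal (hc i)]
    exact Finset.sum_coe_sort _ fun y =>
      (binFun y.1 (h i).1 k.1 * binFun y.2 (h i).2 k.2) • c i (D - h i - y) y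

end Uniqueness

section MultiBinomial

variable {K : Type*} [Field K] [CharZero K] {E : Type*} [AddCommGroup E] [Module K E]

/-- the inclusion `ℕ² → K²` -/
def natIdx (k : ℕ × ℕ) : Idx K := (k.1, k.2)

lemma natIdx_add (k l : ℕ × ℕ) : (natIdx (k + l) : Idx K) = natIdx k + natIdx l := by
  ext <;> simp [natIdx]

/-- the coefficients of `(𝐳 - 𝐰)^h` -/
def binCoef₂ (h : Idx K) (k : ℕ × ℕ) : K := binCoef h.1 k.1 * binCoef h.2 k.2

/-- the index shift produced by a monomial of `∏_p (𝐳_{src p} - 𝐳_{dst p})^{hs p}` -/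
def totShift {P : Type*} [Fintype P] {n : ℕ} (src dst : P → Fin n) (hs : P → Idx K)
    (κ : P → ℕ × ℕ) : Fin n → Idx K :=
  ∑ p, (Pi.single (src p) (hs p - natIdx (κ p)) + Pi.single (dst p) (natIdx (κ p)))

/-- multiplication by `∏_p (𝐳_{src p} - 𝐳_{dst p})^{hs p}` -/
def binMul {P : Type*} [Fintype P] {n : ℕ} (src dst : P → Fin n) (hs : P → Idx K)
    (c : DistN K E n) : DistN K E n :=
  fun m => ∑ᶠ κ : P → ℕ × ℕ, (∏ p, binCoef₂ (hs p) (κ p)) • c (m + totShift src dst hs κ)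

/-- the first components of `src` and `dst` when each pair `(a p, b p)` with `fl p` is flipped -/
def flipFst {P : Type*} {n : ℕ} (a b : P → Fin n) (fl : P → Bool) (p : P) : Fin n :=
  if fl p then b p else a p

/-- the sign `∏_{fl p} (-1)^{hs p}` -/
def flipSign {P : Type*} [Fintype P] (fl : P → Bool) (hs : P → Idx K) : K :=
  ∏ p, if fl p then negOnePow K ((hs p).1 - (hs p).2) else 1

/-- multiplication by `∏_p (𝐳_{a p} - 𝐳_{b p})^{hs p}`, where the factors with `fl p` are expanded
in the opposite domain -/
def flipMul {P : Type*} [Fintype P] {n : ℕ} (a b : P → Fin n) (fl : P → Bool) (hs : P → Idx K)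
    (c : DistN K E n) : DistN K E n :=
  fun m => flipSign fl hs • binMul (flipFst a b fl) (flipFst b a fl) hs c m

lemma permMul_eq {n : ℕ} (σ : Equiv.Perm (Fin n)) (hs : Pairs n → Idx K) (c : DistN K E n)
    (m : Fin n → Idx K) :
    permMul K E σ hs c m =
      flipMul (fun p => p.1.1) (fun p => p.1.2) (flipOf σ) hs c m := by
  rw [permMul, flipMul, binMul, smul_finsum]
  refine finsum_congr fun κ => ?_
  rw [smul_smul, flipSign, ← Finset.prod_mul_distrib]
  congr 1
  · refine Finset.prod_congr rfl fun p _ => ?_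
    simp only [pairCoef, binCoef₂, binCoef, pow_add]
    ring
  · congr 1
    funext i
    simp only [Pi.add_apply, totShift, Finset.sum_apply]
    congr 1
    refine Finset.sum_congr rfl fun p _ => ?_
    have h1 : p.1.1 ≠ p.1.2 := p.2.ne
    simp only [pairShift, Pi.single_apply, flipFst, natIdx]
    cases flipOf σ p
    · by_cases h2 : i = p.1.1
      · simp [h2, h1]
        rfl
      · by_cases h3 : i = p.1.2
        · simp [h3, h1.symm]
        · simp [h2, h3]
    · by_cases h2 : i = p.1.1
      · simp [h2, h1]
      · by_cases h3 : i = p.1.2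
        · simp [h3, h1.symm]
          rfl
        · simp [h2, h3]

lemma binMul_comp_equiv {P Q : Type*} [Fintype P] [Fintype Q] {n : ℕ} (e : Q ≃ P)
    (src dst : P → Fin n) (hs : P → Idx K) (c : DistN K E n) :
    binMul (src ∘ e) (dst ∘ e) (hs ∘ e) c = binMul src dst hs c := by
  funext m
  rw [binMul, binMul, ← finsum_comp_equiv (e.arrowCongr (Equiv.refl _)).symm]
  refine finsum_congr fun κ => ?_
  congr 1
  · exact e.prod_comp fun p => binCoef₂ (hs p) (κ p)
  · congr 2
    exact e.sum_comp fun p => (Pi.single (src p) (hs p - natIdx (κ p)) +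
      Pi.single (dst p) (natIdx (κ p)) : Fin n → Idx K)

lemma flipMul_comp_equiv {P Q : Type*} [Fintype P] [Fintype Q] {n : ℕ} (e : Q ≃ P)
    (a b : P → Fin n) (fl : P → Bool) (hs : P → Idx K) (c : DistN K E n) :
    flipMul (a ∘ e) (b ∘ e) (fl ∘ e) (hs ∘ e) c = flipMul a b fl hs c := by
  funext m
  rw [flipMul, flipMul, ← binMul_comp_equiv e]
  congr 1
  exact e.prod_comp fun p => if fl p then negOnePow K ((hs p).1 - (hs p).2) else 1

lemma totShift_sumElim {P Q : Type*} [Fintype P] [Fintype Q] {n : ℕ} (src dst : P → Fin n)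
    (src' dst' : Q → Fin n) (hs : P → Idx K) (hs' : Q → Idx K) (κ : P → ℕ × ℕ) (κ' : Q → ℕ × ℕ) :
    totShift (Sum.elim src src') (Sum.elim dst dst') (Sum.elim hs hs') (Sum.elim κ κ') =
      totShift src dst hs κ + totShift src' dst' hs' κ' := by
  simp [totShift, Fintype.sum_sum_type]

lemma binMul_sumElim {P Q : Type*} [Fintype P] [Fintype Q] {n : ℕ} (src dst : P → Fin n)
    (src' dst' : Q → Fin n) (hs : P → Idx K) (hs' : Q → Idx K) (c : DistN K E n)
    (m : Fin n → Idx K)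
    (hfin : {κ : P ⊕ Q → ℕ × ℕ | c (m + totShift (Sum.elim src src') (Sum.elim dst dst')
      (Sum.elim hs hs') κ) ≠ 0}.Finite) :
    binMul (Sum.elim src src') (Sum.elim dst dst') (Sum.elim hs hs') c m =
      binMul src dst hs (binMul src' dst' hs' c) m := by
  rw [binMul, ← finsum_comp_equiv (Equiv.sumArrowEquivProdArrow P Q (ℕ × ℕ)).symm, finsum_curry]
  · refine finsum_congr fun κ => ?_
    rw [binMul, smul_finsum]
    refine finsum_congr fun κ' => ?_
    rw [smul_smul, add_assoc, ← totShift_sumElim]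
    congr 1
    simp [Fintype.prod_sum_type]
  · refine (hfin.preimage (Equiv.sumArrowEquivProdArrow P Q (ℕ × ℕ)).symm.injective.injOn).subset ?_
    intro κ hκ
    exact right_ne_zero_of_smul hκ

end MultiBinomial

section Finiteness

variable {K : Type*} [Field K] [CharZero K] {E : Type*} [AddCommGroup E] [Module K E]

lemma exists_exponent_bound_aux {P : Type*} [Fintype P] {n : ℕ} (src dst : P → Fin n)
    (w : Fin n → ℕ) (hw : ∀ p, w (src p) ≤ w (dst p)) (h : P → K) (s m : Fin n → K) :
    ∃ N : ℕ, ∀ (m' : Fin n → K) (k : P → ℕ), (∀ i, w i ≠ 0 → m' i = m i) →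
      (∀ i, IsNegInt K ((m' i + ∑ p, ((if src p = i then h p - k p else 0) +
        (if dst p = i then (k p : K) else 0))) - s i)) →
      ∀ q, w (src q) < w (dst q) → k q ≤ N := by
  let C : K := -∑ i, w i * (m i - s i + 1) - ∑ p, w (src p) * h p
  have key : ∀ (m' : Fin n → K) (k : P → ℕ), (∀ i, w i ≠ 0 → m' i = m i) →
      (∀ i, IsNegInt K ((m' i + ∑ p, ((if src p = i then h p - k p else 0) +
        (if dst p = i then (k p : K) else 0))) - s i)) →
      ∃ X : ℕ, (X : K) = C ∧ ∀ q, w (src q) < w (dst q) → k q ≤ X := by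
    intro m' k hm hneg
    choose t ht using fun i => isNegInt_iff.1 (hneg i)
    refine ⟨∑ i, w i * t i + ∑ p, (w (dst p) - w (src p)) * k p, ?_, fun q hq => ?_⟩
    · have h1 : ∑ i, (w i : K) * ∑ p, ((if src p = i then h p - k p else 0) +
          (if dst p = i then (k p : K) else 0)) =
          ∑ p, ((w (src p) : K) * (h p - k p) + w (dst p) * k p) := by
        simp only [Finset.mul_sum]
        rw [Finset.sum_comm]
        refine Finset.sum_congr rfl fun p _ => ?_
        simp [mul_add, Finset.sum_add_distrib]
      have h2 : ∑ i, (w i : K) * t i = -∑ i, w i * (m i - s i + 1) -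
          ∑ i, (w i : K) * ∑ p, ((if src p = i then h p - k p else 0) +
          (if dst p = i then (k p : K) else 0)) := by
        rw [← Finset.sum_neg_distrib, ← Finset.sum_sub_distrib]
        refine Finset.sum_congr rfl fun i _ => ?_
        by_cases hi : w i = 0
        · simp [hi]
        · rw [← hm i hi]
          linear_combination (w i : K) * ht i
      have h3 : ((∑ p, (w (dst p) - w (src p)) * k p : ℕ) : K) =
          ∑ p, ((w (src p) : K) * (h p - k p) + w (dst p) * k p) - ∑ p, w (src p) * h p := by
        rw [← Finset.sum_sub_distrib, Nat.cast_sum]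
        refine Finset.sum_congr rfl fun p _ => ?_
        rw [Nat.cast_mul, Nat.cast_sub (hw p)]
        ring
      rw [Nat.cast_add, h3, Nat.cast_sum]
      simp only [Nat.cast_mul]
      rw [h2, h1]
      ring
    · refine le_trans (le_trans ?_ (Finset.single_le_sum
        (f := fun p => (w (dst p) - w (src p)) * k p) (fun _ _ => Nat.zero_le _)
        (Finset.mem_univ q))) (Nat.le_add_left _ _)
      exact Nat.le_mul_of_pos_left _ (Nat.sub_pos_of_lt hq)
  by_cases hC : ∃ X : ℕ, (X : K) = C
  · obtain ⟨N, hN⟩ := hC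
    refine ⟨N, fun m' k hm hneg q hq => ?_⟩
    obtain ⟨X, hX, hX'⟩ := key m' k hm hneg
    have : X = N := by exact_mod_cast hX.trans hN.symm
    exact this ▸ hX' q hq
  · refine ⟨0, fun m' k hm hneg => ?_⟩
    obtain ⟨X, hX, -⟩ := key m' k hm hneg
    exact (hC ⟨X, hX⟩).elim

lemma totShift_fst {P : Type*} [Fintype P] {n : ℕ} (src dst : P → Fin n) (hs : P → Idx K)
    (κ : P → ℕ × ℕ) (i : Fin n) : (totShift src dst hs κ i).1 =
      ∑ p, ((if src p = i then (hs p).1 - (κ p).1 else 0) +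
        (if dst p = i then ((κ p).1 : K) else 0)) := by
  rw [totShift, Finset.sum_apply, Prod.fst_sum]
  refine Finset.sum_congr rfl fun p _ => ?_
  simp only [Pi.add_apply, Pi.single_apply, Prod.fst_add, eq_comm (a := i)]
  split_ifs <;> simp [natIdx]

lemma totShift_snd {P : Type*} [Fintype P] {n : ℕ} (src dst : P → Fin n) (hs : P → Idx K)
    (κ : P → ℕ × ℕ) (i : Fin n) : (totShift src dst hs κ i).2 =
      ∑ p, ((if src p = i then (hs p).2 - (κ p).2 else 0) +
        (if dst p = i then ((κ p).2 : K) else 0)) := by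
  rw [totShift, Finset.sum_apply, Prod.snd_sum]
  refine Finset.sum_congr rfl fun p _ => ?_
  simp only [Pi.add_apply, Pi.single_apply, Prod.snd_add, eq_comm (a := i)]
  split_ifs <;> simp [natIdx]

/-- the exponents contributing to a product of binomials that are expanded compatibly with the
weight `w` are bounded, uniformly in the indices of the variables of weight zero -/
lemma exists_exponent_bound {P : Type*} [Fintype P] {n : ℕ} (src dst : P → Fin n)
    (w : Fin n → ℕ) (hw : ∀ p, w (src p) ≤ w (dst p)) (hs : P → Idx K) {c : DistN K E n}
    (hc : InLatN K E c) (m : Fin n → Idx K) :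
    ∃ N : ℕ, ∀ (m' : Fin n → Idx K) (κ : P → ℕ × ℕ), (∀ i, w i ≠ 0 → m' i = m i) →
      c (m' + totShift src dst hs κ) ≠ 0 →
      ∀ q, w (src q) < w (dst q) → (κ q).1 ≤ N ∧ (κ q).2 ≤ N := by
  obtain ⟨S, hS⟩ := hc
  choose N hN using fun s : Fin n → Idx K => exists_exponent_bound_aux src dst w hw
    (fun p => (hs p).1) (fun i => (s i).1) (fun i => (m i).1)
  choose N' hN' using fun s : Fin n → Idx K => exists_exponent_bound_aux src dst w hw
    (fun p => (hs p).2) (fun i => (s i).2) (fun i => (m i).2)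
  refine ⟨S.sup N + S.sup N', fun m' κ hm hκ q hq => ?_⟩
  obtain ⟨s, hs, h⟩ := hS _ hκ
  have h1 := hN s (fun i => (m' i).1) (fun p => (κ p).1) (fun i hi => by rw [hm i hi])
    (fun i => by
      have := (h i).1
      rwa [Pi.add_apply, Prod.fst_add, totShift_fst] at this) q hq
  have h2 := hN' s (fun i => (m' i).2) (fun p => (κ p).2) (fun i hi => by rw [hm i hi])
    (fun i => by
      have := (h i).2
      rwa [Pi.add_apply, Prod.snd_add, totShift_snd] at this) q hq
  have h3 := Finset.le_sup (f := N) hs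
  have h4 := Finset.le_sup (f := N') hs
  constructor <;> omega

lemma finite_exponents {P : Type*} [Fintype P] {n : ℕ} (src dst : P → Fin n)
    (w : Fin n → ℕ) (hw : ∀ p, w (src p) < w (dst p)) (hs : P → Idx K) {c : DistN K E n}
    (hc : InLatN K E c) (m : Fin n → Idx K) :
    {κ : P → ℕ × ℕ | c (m + totShift src dst hs κ) ≠ 0}.Finite := by
  obtain ⟨N, hN⟩ := exists_exponent_bound src dst w (fun p => (hw p).le) hs hc m
  refine (Set.Finite.pi' fun _ : P => Set.finite_Iic (N, N)).subset fun κ hκ q => ?_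
  exact hN m κ (fun _ _ => rfl) hκ q (hw q)

end Finiteness

section Leibniz

variable {K : Type*} [Field K] [CharZero K] {E : Type*} [AddCommGroup E] [Module K E]

lemma negOnePow_intCast (k : ℤ) : negOnePow K (k : K) = (-1) ^ k := by
  have h : ∃ l : ℤ, (l : K) = (k : K) := ⟨k, rfl⟩
  have h' : h.choose = k := by exact_mod_cast h.choose_spec
  rw [negOnePow, dif_pos h, h']

lemma negOnePow_add {x y : K} (hx : IsInt K x) (hy : IsInt K y) :
    negOnePow K (x + y) = negOnePow K x * negOnePow K y := by
  obtain ⟨k, rfl⟩ := hx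
  obtain ⟨l, rfl⟩ := hy
  rw [← Int.cast_add, negOnePow_intCast, negOnePow_intCast, negOnePow_intCast,
    zpow_add₀ (neg_ne_zero.2 one_ne_zero)]

/-- `pr` is one of the two coordinates of `K²` and `u` the corresponding unit vector -/
structure IsCoord (pr : Idx K →+ K) (u : ℕ × ℕ) : Prop where
  unit : pr (natIdx u) = 1
  mul_sub : ∀ (h : Idx K) (k : ℕ × ℕ),
    binCoef₂ h k * (pr h - pr (natIdx k)) = pr h * binCoef₂ (h - natIdx u) k
  add_unit_mul : ∀ (h : Idx K) (k : ℕ × ℕ),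
    binCoef₂ h (k + u) * pr (natIdx (k + u)) = -pr h * binCoef₂ (h - natIdx u) k
  exists_eq_add : ∀ k : ℕ × ℕ, pr (natIdx k) ≠ 0 → ∃ k', k = k' + u
  negOnePow_sub : ∀ h : Idx K, Kbar K h →
    negOnePow K ((h - natIdx u).1 - (h - natIdx u).2) = -negOnePow K (h.1 - h.2)
  kbar_sub : ∀ h : Idx K, Kbar K h → Kbar K (h - natIdx u)

lemma isCoord_fst : IsCoord (AddMonoidHom.fst K K) (1, 0) where
  unit := by simp [natIdx]
  mul_sub h k := by
    simp only [binCoef₂, natIdx, AddMonoidHom.coe_fst, Prod.fst_sub, Prod.snd_sub, Nat.cast_one,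
      Nat.cast_zero, sub_zero]
    linear_combination binCoef h.2 k.2 * binCoef_mul_sub h.1 k.1
  add_unit_mul h k := by
    simp only [binCoef₂, natIdx, AddMonoidHom.coe_fst, Prod.fst_sub, Prod.snd_sub, Nat.cast_one,
      Nat.cast_zero, sub_zero, Prod.fst_add, Prod.snd_add, add_zero]
    linear_combination binCoef h.2 k.2 * binCoef_succ_mul h.1 k.1
  exists_eq_add k hk := by
    obtain ⟨k, k'⟩ := k
    cases k with
    | zero => simp [natIdx] at hk
    | succ k => exact ⟨(k, k'), rfl⟩
  negOnePow_sub h hh := by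
    have h1 := negOnePow_add hh (y := ((-1 : ℤ) : K)) ⟨-1, rfl⟩
    rw [negOnePow_intCast] at h1
    convert h1 using 1
    · congr 1
      simp [natIdx]
      ring
    · simp
  kbar_sub h := by
    rintro ⟨k, hk⟩
    refine ⟨k - 1, ?_⟩
    push_cast
    rw [hk]
    simp [natIdx]
    ring

lemma isCoord_snd : IsCoord (AddMonoidHom.snd K K) (0, 1) where
  unit := by simp [natIdx]
  mul_sub h k := by
    simp only [binCoef₂, natIdx, AddMonoidHom.coe_snd, Prod.fst_sub, Prod.snd_sub, Nat.cast_one,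
      Nat.cast_zero, sub_zero]
    linear_combination binCoef h.1 k.1 * binCoef_mul_sub h.2 k.2
  add_unit_mul h k := by
    simp only [binCoef₂, natIdx, AddMonoidHom.coe_snd, Prod.fst_sub, Prod.snd_sub, Nat.cast_one,
      Nat.cast_zero, sub_zero, Prod.fst_add, Prod.snd_add, add_zero]
    linear_combination binCoef h.1 k.1 * binCoef_succ_mul h.2 k.2
  exists_eq_add k hk := by
    obtain ⟨k', k⟩ := k
    cases k with
    | zero => simp [natIdx] at hk
    | succ k => exact ⟨(k', k), rfl⟩
  negOnePow_sub h hh := by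
    have h1 := negOnePow_add hh (y := ((1 : ℤ) : K)) ⟨1, rfl⟩
    rw [negOnePow_intCast] at h1
    convert h1 using 1
    · congr 1
      simp [natIdx]
      ring
    · simp
  kbar_sub h := by
    rintro ⟨k, hk⟩
    refine ⟨k + 1, ?_⟩
    push_cast
    rw [hk]
    simp [natIdx]
    ring

/-- the partial derivative of a distribution in the `i`-th variable along a coordinate -/
def derivN (pr : Idx K →+ K) (u : ℕ × ℕ) {n : ℕ} (i : Fin n) (c : DistN K E n) : DistN K E n :=
  fun m => (-pr (m i)) • c (m - Pi.single i (natIdx u))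

lemma sum_add_eq_sum {P M : Type*} [Fintype P] [AddCommMonoid M] {f g : P → M} (p : P) {x : M}
    (hp : f p + x = g p) (h : ∀ q, q ≠ p → f q = g q) : ∑ q, f q + x = ∑ q, g q := by
  rw [← Finset.add_sum_erase _ f (Finset.mem_univ p),
    ← Finset.add_sum_erase _ g (Finset.mem_univ p), add_right_comm, hp,
    Finset.sum_congr rfl fun q hq => h q (Finset.ne_of_mem_erase hq)]

lemma mul_prod_eq_mul_prod {P : Type*} [Fintype P] {f g : P → K} (p : P) {r s : K}
    (hp : r * f p = s * g p) (h : ∀ q, q ≠ p → f q = g q) : r * ∏ q, f q = s * ∏ q, g q := by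
  rw [← Finset.mul_prod_erase _ f (Finset.mem_univ p),
    ← Finset.mul_prod_erase _ g (Finset.mem_univ p), ← mul_assoc, hp,
    Finset.prod_congr rfl fun q hq => h q (Finset.ne_of_mem_erase hq), mul_assoc]

lemma totShift_sub_single {P : Type*} [Fintype P] {n : ℕ} (src dst : P → Fin n) (hs : P → Idx K)
    (κ : P → ℕ × ℕ) (p : P) (x : Idx K) :
    totShift src dst (hs - Pi.single p x) κ = totShift src dst hs κ - Pi.single (src p) x := by
  rw [eq_sub_iff_add_eq]
  refine sum_add_eq_sum p ?_ fun q hq => ?_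
  · rw [Pi.sub_apply, Pi.single_eq_same, add_right_comm, ← Pi.single_add]
    congr 2
    abel
  · rw [Pi.sub_apply, Pi.single_eq_of_ne hq, sub_zero]

lemma totShift_add_single {P : Type*} [Fintype P] {n : ℕ} (src dst : P → Fin n) (hs : P → Idx K)
    (κ : P → ℕ × ℕ) (p : P) (u : ℕ × ℕ) :
    totShift src dst hs (κ + Pi.single p u) =
      totShift src dst (hs - Pi.single p (natIdx u)) κ + Pi.single (dst p) (natIdx u) := by
  rw [totShift_sub_single, sub_add_eq_add_sub, eq_sub_iff_add_eq, ← add_neg_eq_iff_eq_add,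
    add_assoc]
  refine sum_add_eq_sum p ?_ fun q hq => ?_
  · have h : (Pi.single (src p) (hs p - (natIdx (κ p) + natIdx u)) : Fin n → Idx K) =
        Pi.single (src p) (hs p - natIdx (κ p)) - Pi.single (src p) (natIdx u) := by
      rw [← Pi.single_sub, sub_sub]
    rw [Pi.add_apply, Pi.single_eq_same, natIdx_add, Pi.single_add, h]
    abel
  · rw [Pi.add_apply, Pi.single_eq_of_ne hq, add_zero]

lemma IsCoord.finsum_src {pr : Idx K →+ K} {u : ℕ × ℕ} (hu : IsCoord pr u) {P : Type*}
    [Fintype P] {n : ℕ} (src dst : P → Fin n) (hs : P → Idx K) (c : DistN K E n)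
    (m : Fin n → Idx K) (p : P) :
    ∑ᶠ κ : P → ℕ × ℕ, ((pr (hs p) - pr (natIdx (κ p))) * ∏ q, binCoef₂ (hs q) (κ q)) •
        c (m - Pi.single (src p) (natIdx u) + totShift src dst hs κ) =
      pr (hs p) • binMul src dst (hs - Pi.single p (natIdx u)) c m := by
  rw [binMul, smul_finsum]
  refine finsum_congr fun κ => ?_
  rw [smul_smul, totShift_sub_single, sub_add_eq_add_sub, add_sub_assoc]
  congr 1
  refine mul_prod_eq_mul_prod p ?_ fun q hq => ?_
  · rw [mul_comm, hu.mul_sub, Pi.sub_apply, Pi.single_eq_same]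
  · rw [Pi.sub_apply, Pi.single_eq_of_ne hq, sub_zero]

lemma IsCoord.finsum_dst {pr : Idx K →+ K} {u : ℕ × ℕ} (hu : IsCoord pr u) {P : Type*}
    [Fintype P] {n : ℕ} (src dst : P → Fin n) (hs : P → Idx K) (c : DistN K E n)
    (m : Fin n → Idx K) (p : P) :
    ∑ᶠ κ : P → ℕ × ℕ, (pr (natIdx (κ p)) * ∏ q, binCoef₂ (hs q) (κ q)) •
        c (m - Pi.single (dst p) (natIdx u) + totShift src dst hs κ) =
      -pr (hs p) • binMul src dst (hs - Pi.single p (natIdx u)) c m := by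
  rw [binMul, smul_finsum,
    ← finsum_comp_of_injective (add_left_injective (Pi.single p u : P → ℕ × ℕ))]
  · refine finsum_congr fun κ => ?_
    rw [smul_smul, totShift_add_single, add_comm (totShift _ _ _ _), ← add_assoc, sub_add_cancel]
    congr 1
    refine mul_prod_eq_mul_prod p ?_ fun q hq => ?_
    · rw [mul_comm, Pi.add_apply, Pi.single_eq_same, hu.add_unit_mul, Pi.sub_apply,
        Pi.single_eq_same]
    · rw [Pi.sub_apply, Pi.add_apply, Pi.single_eq_of_ne hq, Pi.single_eq_of_ne hq, sub_zero,
        add_zero]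
  · intro κ hκ
    obtain ⟨k', hk'⟩ := hu.exists_eq_add _ (left_ne_zero_of_mul (left_ne_zero_of_smul hκ))
    refine ⟨Function.update κ p k', ?_⟩
    funext q
    by_cases hq : q = p
    · subst hq
      simp [hk']
    · simp [hq]

lemma IsCoord.derivN_binMul {pr : Idx K →+ K} {u : ℕ × ℕ} (hu : IsCoord pr u) {P : Type*}
    [Fintype P] {n : ℕ} (src dst : P → Fin n) (hs : P → Idx K) (c : DistN K E n) (i : Fin n)
    (hfin : ∀ m, {κ : P → ℕ × ℕ | c (m + totShift src dst hs κ) ≠ 0}.Finite)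
    (m : Fin n → Idx K) :
    derivN pr u i (binMul src dst hs c) m = binMul src dst hs (derivN pr u i c) m +
      ∑ p, (((if src p = i then 1 else 0) - (if dst p = i then 1 else 0)) * pr (hs p)) •
        binMul src dst (hs - Pi.single p (natIdx u)) c m := by
  let e : Fin n → Idx K := Pi.single i (natIdx u)
  let B : (P → ℕ × ℕ) → K := fun κ => ∏ q, binCoef₂ (hs q) (κ q)
  have hfin' : ∀ φ : (P → ℕ × ℕ) → K,
      (fun κ => φ κ • c (m - e + totShift src dst hs κ)).HasFiniteSupport := fun φ =>
    (hfin (m - e)).subset fun κ hκ => right_ne_zero_of_smul hκ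
  have h1 : ∀ p, (((if src p = i then 1 else 0) - (if dst p = i then 1 else 0)) * pr (hs p)) •
        binMul src dst (hs - Pi.single p (natIdx u)) c m =
      ∑ᶠ κ, (((if src p = i then pr (hs p) - pr (natIdx (κ p)) else 0) +
        (if dst p = i then pr (natIdx (κ p)) else 0)) * B κ) •
          c (m - e + totShift src dst hs κ) := by
    intro p
    simp only [add_mul, add_smul]
    rw [finsum_add_distrib (hfin' _) (hfin' _), sub_mul, sub_smul, sub_eq_add_neg]
    congr 1
    · split_ifs with h
      · rw [one_mul, ← hu.finsum_src]
        simp only [e, h, B]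
      · simp
    · split_ifs with h
      · rw [one_mul, ← neg_smul, ← hu.finsum_dst]
        simp only [e, h, B]
      · simp
  have h2 : ∀ κ, pr (totShift src dst hs κ i) =
      ∑ p, ((if src p = i then pr (hs p) - pr (natIdx (κ p)) else 0) +
        (if dst p = i then pr (natIdx (κ p)) else 0)) := by
    intro κ
    rw [totShift, Finset.sum_apply, map_sum]
    refine Finset.sum_congr rfl fun p _ => ?_
    simp only [Pi.add_apply, Pi.single_apply, map_add, eq_comm (a := i)]
    split_ifs <;> simp
  rw [Finset.sum_congr rfl fun p _ => h1 p, ← finsum_sum_comm _ _ fun p _ => hfin' _, binMul,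
    derivN, binMul, smul_finsum, ← finsum_add_distrib]
  · refine finsum_congr fun κ => ?_
    rw [← Finset.sum_smul, ← Finset.sum_mul, ← h2, derivN, add_sub_right_comm, smul_smul, smul_smul,
      ← add_smul]
    congr 1
    simp only [Pi.add_apply, map_add, B]
    ring
  · refine (hfin (m - e)).subset fun κ hκ => ?_
    have := right_ne_zero_of_smul (right_ne_zero_of_smul hκ)
    rwa [add_sub_right_comm] at this
  · simp only [← Finset.sum_smul]
    exact hfin' _

lemma IsCoord.flipSign_sub_single {pr : Idx K →+ K} {u : ℕ × ℕ} (hu : IsCoord pr u) {P : Type*}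
    [Fintype P] (fl : P → Bool) (hs : P → Idx K) (hK : ∀ p, Kbar K (hs p)) (p : P) :
    flipSign fl (hs - Pi.single p (natIdx u)) =
      (if fl p then -1 else 1) * flipSign fl hs := by
  rw [← one_mul (flipSign fl (hs - _))]
  refine mul_prod_eq_mul_prod p ?_ fun q hq => ?_
  · rw [Pi.sub_apply, Pi.single_eq_same, hu.negOnePow_sub _ (hK p)]
    split_ifs <;> simp
  · rw [Pi.sub_apply, Pi.single_eq_of_ne hq, sub_zero]

lemma IsCoord.derivN_flipMul {pr : Idx K →+ K} {u : ℕ × ℕ} (hu : IsCoord pr u) {P : Type*}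
    [Fintype P] {n : ℕ} (a b : P → Fin n) (fl : P → Bool) (hs : P → Idx K)
    (hK : ∀ p, Kbar K (hs p)) (c : DistN K E n) (i : Fin n)
    (hfin : ∀ m, {κ : P → ℕ × ℕ |
      c (m + totShift (flipFst a b fl) (flipFst b a fl) hs κ) ≠ 0}.Finite)
    (m : Fin n → Idx K) :
    derivN pr u i (flipMul a b fl hs c) m = flipMul a b fl hs (derivN pr u i c) m +
      ∑ p, (((if a p = i then 1 else 0) - (if b p = i then 1 else 0)) * pr (hs p)) •
        flipMul a b fl (hs - Pi.single p (natIdx u)) c m := by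
  have h1 : derivN pr u i (flipMul a b fl hs c) m = flipSign fl hs •
      derivN pr u i (binMul (flipFst a b fl) (flipFst b a fl) hs c) m := by
    rw [derivN, derivN, flipMul, smul_comm]
  rw [h1, hu.derivN_binMul _ _ _ _ _ hfin, smul_add, Finset.smul_sum]
  congr 1
  refine Finset.sum_congr rfl fun p _ => ?_
  rw [flipMul, hu.flipSign_sub_single _ _ hK, smul_smul, smul_smul]
  congr 1
  by_cases hf : fl p = true
  · simp only [flipFst, hf, if_true]
    ring
  · simp only [flipFst, hf, Bool.false_eq_true, if_false]
    ring

end Leibniz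

section Diagonal

variable {K : Type*} [Field K] [CharZero K] {E : Type*} [AddCommGroup E] [Module K E] {r : ℕ}

lemma IsNegInt.of_add_natCast {x : K} {k : ℕ} (h : IsNegInt K (x + k)) : IsNegInt K x := by
  obtain ⟨t, ht⟩ := isNegInt_iff.1 h
  exact isNegInt_iff.2 ⟨t + k, by push_cast; linear_combination ht⟩

/-- the index of `r + 2` variable pairs with the given first two entries -/
def join (x y : Idx K) (t : Fin r → Idx K) : Fin (r + 2) → Idx K := Fin.cons x (Fin.cons y t)

lemma join_zero (x y : Idx K) (t : Fin r → Idx K) : join x y t 0 = x := rfl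

lemma join_one (x y : Idx K) (t : Fin r → Idx K) : join x y t 1 = y := rfl

lemma join_succ_succ (x y : Idx K) (t : Fin r → Idx K) (j : Fin r) :
    join x y t j.succ.succ = t j := rfl

/-- a distribution as a distribution in its first two variable pairs -/
def slice (c : DistN K E (r + 2)) (t : Fin r → Idx K) : Dist2 K E := fun x y => c (join x y t)

/-- the diagonal map in the first two variable pairs -/
def diagN (c : DistN K E (r + 2)) : DistN K E (r + 1) :=
  fun m => diag K E (slice c (Fin.tail m)) (m 0)

/-- the index of the diagonal of the first two variable pairs -/
def antidiag (m : Fin (r + 1) → Idx K) (x : Idx K) : Fin (r + 2) → Idx K :=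
  join x (m 0 - x - 1) (Fin.tail m)

lemma diagN_apply (c : DistN K E (r + 2)) (m : Fin (r + 1) → Idx K) :
    diagN c m = ∑ᶠ x, c (antidiag m x) := rfl

/-- the identification of the first two variables -/
def collapse : Fin (r + 2) → Fin (r + 1) := Fin.cons 0 id

/-- the map on indices induced by the identification of the first two variables -/
def collapseIdx : (Fin (r + 2) → Idx K) →+ (Fin (r + 1) → Idx K) where
  toFun v := Fin.cons (v 0 + v 1) fun j => v j.succ.succ
  map_zero' := by
    funext i
    refine Fin.cases ?_ (fun i => rfl) i
    exact add_zero _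
  map_add' v v' := by
    funext i
    refine Fin.cases ?_ (fun i => rfl) i
    exact add_add_add_comm _ _ _ _

lemma collapseIdx_single (i : Fin (r + 2)) (x : Idx K) :
    collapseIdx (Pi.single i x) = Pi.single (collapse i) x := by
  funext j
  refine Fin.cases ?_ (fun j => ?_) j
  · refine Fin.cases ?_ (fun i => Fin.cases ?_ (fun i => ?_) i) i <;>
      simp [collapseIdx, collapse, Pi.single_apply, Fin.ext_iff]
  · refine Fin.cases ?_ (fun i => Fin.cases ?_ (fun i => ?_) i) i <;>
      simp [collapseIdx, collapse, Pi.single_apply, Fin.ext_iff]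

lemma collapseIdx_totShift {P : Type*} [Fintype P] (src dst : P → Fin (r + 2)) (hs : P → Idx K)
    (κ : P → ℕ × ℕ) : collapseIdx (totShift src dst hs κ) =
      totShift (collapse ∘ src) (collapse ∘ dst) hs κ := by
  simp [totShift, collapseIdx_single]

lemma antidiag_add_collapseIdx (m : Fin (r + 1) → Idx K) (v : Fin (r + 2) → Idx K) (x : Idx K) :
    antidiag (m + collapseIdx v) (x + v 0) = antidiag m x + v := by
  funext i
  refine Fin.cases ?_ (fun i => Fin.cases ?_ (fun i => ?_) i) i
  · rfl
  · change m 0 + (v 0 + v 1) - (x + v 0) - 1 = m 0 - x - 1 + v 1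
    abel
  · rfl

lemma finite_antidiag {c : DistN K E (r + 2)} (hc : InLatN K E c) (m : Fin (r + 1) → Idx K) :
    {x | c (antidiag m x) ≠ 0}.Finite := by
  obtain ⟨S, hS⟩ := hc
  refine (Set.Finite.biUnion S.finite_toSet fun s _ =>
    (finite_setOf_isNegInt (s 0).1 ((s 1).1 + 1) (m 0).1).prod
      (finite_setOf_isNegInt (s 0).2 ((s 1).2 + 1) (m 0).2)).subset fun x hx => ?_
  obtain ⟨s, hs, h⟩ := hS _ hx
  refine Set.mem_biUnion hs ?_
  have h1 := h 1
  simp only [antidiag, join_one, Prod.fst_sub, Prod.snd_sub, Prod.fst_one, Prod.snd_one] at h1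
  refine ⟨⟨(h 0).1, ?_⟩, (h 0).2, ?_⟩
  · convert h1.1 using 1
    ring
  · convert h1.2 using 1
    ring

/-- the support of the diagonal lies in a finite union of translated lattice cones -/
lemma inLatN_antidiag {c : DistN K E (r + 2)} (hc : InLatN K E c) :
    InLatN K K (fun m : Fin (r + 1) → Idx K => if ∃ x, c (antidiag m x) ≠ 0 then 1 else 0) := by
  obtain ⟨S, hS⟩ := hc
  refine ⟨S.image fun s => Fin.cons (s 0 + s 1 + 1) fun j => s j.succ.succ, fun m hm => ?_⟩
  obtain ⟨x, hx⟩ := (ite_ne_right_iff.1 hm).1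
  obtain ⟨s, hs, h⟩ := hS _ hx
  refine ⟨_, Finset.mem_image_of_mem _ hs, fun i => Fin.cases ?_ (fun i => h i.succ.succ) i⟩
  have h0 := h 0
  have h1 := h 1
  simp only [antidiag, join_zero, join_one, Prod.fst_sub, Prod.snd_sub, Prod.fst_one,
    Prod.snd_one, isNegInt_iff] at h0 h1
  simp only [Fin.cons_zero, Prod.fst_add, Prod.snd_add, Prod.fst_one, Prod.snd_one, isNegInt_iff]
  obtain ⟨⟨t, ht⟩, u, hu⟩ := h0
  obtain ⟨⟨t', ht'⟩, u', hu'⟩ := h1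
  exact ⟨⟨t + t' + 1, by push_cast; linear_combination ht + ht'⟩,
    u + u' + 1, by push_cast; linear_combination hu + hu'⟩

lemma exists_antidiag_ne_zero {c : DistN K E (r + 2)} {m : Fin (r + 1) → Idx K}
    (h : diagN c m ≠ 0) : ∃ x, c (antidiag m x) ≠ 0 := by
  by_contra! h'
  exact h (by simp [diagN_apply, h'])

lemma inLatN_diagN {c : DistN K E (r + 2)} (hc : InLatN K E c) : InLatN K E (diagN c) := by
  obtain ⟨S, hS⟩ := inLatN_antidiag hc
  refine ⟨S, fun m hm => hS m ?_⟩
  simp [exists_antidiag_ne_zero hm]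

lemma diagN_binMul {P : Type*} [Fintype P] (src dst : P → Fin (r + 2)) (w : Fin (r + 1) → ℕ)
    (hw : ∀ p, w (collapse (src p)) < w (collapse (dst p))) (hs : P → Idx K)
    {c : DistN K E (r + 2)} (hc : InLatN K E c) (m : Fin (r + 1) → Idx K) :
    diagN (binMul src dst hs c) m =
      binMul (collapse ∘ src) (collapse ∘ dst) hs (diagN c) m := by
  have hx : ∀ κ, {x | c (antidiag m x + totShift src dst hs κ) ≠ 0}.Finite := fun κ => by
    refine ((finite_antidiag hc (m + collapseIdx (totShift src dst hs κ))).preimage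
      (add_left_injective (totShift src dst hs κ 0)).injOn).subset fun x hx => ?_
    simpa [antidiag_add_collapseIdx] using hx
  have hκ := finite_exponents (collapse ∘ src) (collapse ∘ dst) w hw hs (inLatN_antidiag hc) m
  have hfin : {z : Idx K × (P → ℕ × ℕ) |
      c (antidiag m z.1 + totShift src dst hs z.2) ≠ 0}.Finite := by
    refine (hκ.biUnion fun κ _ => (hx κ).prod (Set.finite_singleton κ)).subset ?_
    rintro ⟨x, κ⟩ hz
    refine Set.mem_biUnion ?_ (show (x, κ) ∈ _ from ⟨hz, rfl⟩)
    change (if ∃ x, c (antidiag (m + totShift (collapse ∘ src) (collapse ∘ dst) hs κ) x) ≠ 0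
      then (1 : K) else 0) ≠ 0
    rw [← collapseIdx_totShift]
    refine ite_ne_right_iff.2 ⟨⟨x + totShift src dst hs κ 0, ?_⟩, one_ne_zero⟩
    rwa [antidiag_add_collapseIdx]
  let f : Idx K → (P → ℕ × ℕ) → E := fun x κ =>
    (∏ p, binCoef₂ (hs p) (κ p)) • c (antidiag m x + totShift src dst hs κ)
  have h1 : ∑ᶠ x, ∑ᶠ κ, f x κ = ∑ᶠ κ, ∑ᶠ x, f x κ := by
    rw [← finsum_curry (fun z : Idx K × (P → ℕ × ℕ) => f z.1 z.2)
      (hfin.subset fun z hz => right_ne_zero_of_smul hz),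
      ← finsum_curry (fun z : (P → ℕ × ℕ) × Idx K => f z.2 z.1)
      ((hfin.preimage Prod.swap_injective.injOn).subset fun z hz => right_ne_zero_of_smul hz)]
    exact finsum_comp_equiv (Equiv.prodComm _ _) (f := fun z : (P → ℕ × ℕ) × Idx K => f z.2 z.1)
  refine h1.trans (finsum_congr fun κ => ?_)
  rw [← smul_finsum, diagN_apply, ← collapseIdx_totShift]
  congr 1
  rw [eq_comm, ← finsum_comp_equiv (Equiv.addRight (totShift src dst hs κ 0))]
  simp only [Equiv.coe_addRight, antidiag_add_collapseIdx]

/-- the slices of a product with binomials are lattice supported if the expansion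
domain is compatible with the identification of the first two variables -/
lemma inLat2_slice_binMul {P : Type*} [Fintype P] (src dst : P → Fin (r + 2))
    (w : Fin (r + 2) → ℕ) (hw : ∀ p, w (src p) ≤ w (dst p)) (h0 : w 0 = 0) (h1 : w 1 = 0)
    (hsrc : ∀ p, src p = 0 ∨ src p = 1 → 0 < w (dst p)) (hs : P → Idx K)
    {c : DistN K E (r + 2)} (hc : InLatN K E c) (t : Fin r → Idx K) :
    InLat2 K E (slice (binMul src dst hs c) t) := by
  obtain ⟨N, hN⟩ := exists_exponent_bound src dst w hw hs hc (join 0 0 t)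
  obtain ⟨S, hS⟩ := hc
  let b : (Fin (r + 2) → Idx K) → (P → ℕ × ℕ) → Fin (r + 2) → Idx K := fun s κ i =>
    s i - ∑ p, if src p = i then hs p - natIdx (κ p) else (0 : Idx K)
  refine ⟨(S ×ˢ Fintype.piFinset fun _ : P => Finset.Iic (N, N)).image fun z =>
    (b z.1 z.2 0, b z.1 z.2 1), fun x y hxy => ?_⟩
  obtain ⟨κ, hκ⟩ : ∃ κ, c (join x y t + totShift src dst hs κ) ≠ 0 := by
    by_contra! h'
    exact hxy (by simp [slice, binMul, h'])
  obtain ⟨s, hs', h⟩ := hS _ hκ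
  have hb := hN (join x y t) κ (fun i => Fin.cases (fun hi => absurd h0 hi)
    (fun i => Fin.cases (fun hi => absurd h1 hi) (fun i _ => rfl) i) i) hκ
  let κ' : P → ℕ × ℕ := fun p => if src p = 0 ∨ src p = 1 then κ p else 0
  have key : ∀ i, i = 0 ∨ i = 1 → IsNegInt K ((join x y t i).1 - (b s κ' i).1) ∧
      IsNegInt K ((join x y t i).2 - (b s κ' i).2) := by
    intro i hi
    have hκ' : b s κ' i = s i - ∑ p, if src p = i then hs p - natIdx (κ p) else 0 := by
      refine congrArg (s i - ·) (Finset.sum_congr rfl fun p _ => ?_)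
      split_ifs with hp
      · simp only [κ', hp, hi, if_true]
      · rfl
    rw [hκ']
    constructor
    · refine IsNegInt.of_add_natCast (k := ∑ p, if dst p = i then (κ p).1 else 0) ?_
      convert (h i).1 using 1
      rw [Pi.add_apply, Prod.fst_add, totShift_fst, Finset.sum_add_distrib]
      simp only [Prod.fst_sub, Prod.fst_sum, apply_ite Prod.fst, natIdx, Prod.fst_zero,
        Nat.cast_sum, Nat.cast_ite, Nat.cast_zero]
      ring
    · refine IsNegInt.of_add_natCast (k := ∑ p, if dst p = i then (κ p).2 else 0) ?_
      convert (h i).2 using 1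
      rw [Pi.add_apply, Prod.snd_add, totShift_snd, Finset.sum_add_distrib]
      simp only [Prod.snd_sub, Prod.snd_sum, apply_ite Prod.snd, natIdx, Prod.snd_zero,
        Nat.cast_sum, Nat.cast_ite, Nat.cast_zero]
      ring
  refine ⟨_, Finset.mem_image_of_mem _ (show (s, κ') ∈ _ from Finset.mem_product.2 ⟨hs', ?_⟩),
    key 0 (Or.inl rfl), key 1 (Or.inr rfl)⟩
  refine Fintype.mem_piFinset.2 fun p => Finset.mem_Iic.2 ?_
  simp only [κ']
  split_ifs with hp
  · refine hb p ?_
    rcases hp with h | h <;> simp only [h, h0, h1] <;> exact hsrc p (by simp [h])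
  · exact ⟨Nat.zero_le _, Nat.zero_le _⟩

end Diagonal

section Merging

variable {K : Type*} [Field K] [CharZero K] {E : Type*} [AddCommGroup E] [Module K E]

lemma binCoef₂_add (h h' : Idx K) (k : ℕ × ℕ) :
    binCoef₂ (h + h') k = ∑ l ∈ Finset.Iic k, binCoef₂ h l * binCoef₂ h' (k - l) := by
  obtain ⟨k, k'⟩ := k
  rw [← Finset.Iic_product_Iic, Finset.sum_product, binCoef₂, Prod.fst_add, Prod.snd_add,
    binCoef_add, binCoef_add, Finset.Nat.sum_antidiagonal_eq_sum_range_succ_mk,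
    Finset.Nat.sum_antidiagonal_eq_sum_range_succ_mk, Finset.sum_mul_sum, Nat.range_succ_eq_Iic,
    Nat.range_succ_eq_Iic]
  refine Finset.sum_congr rfl fun l _ => Finset.sum_congr rfl fun l' _ => ?_
  simp only [binCoef₂, Prod.fst_sub, Prod.snd_sub]
  ring

lemma finsum_add_fiberwise {J : Type*} [Fintype J] (f : (J → ℕ × ℕ) → (J → ℕ × ℕ) → E)
    (hf : (fun z : (J → ℕ × ℕ) × (J → ℕ × ℕ) => f z.1 z.2).HasFiniteSupport) :
    ∑ᶠ z : (J → ℕ × ℕ) × (J → ℕ × ℕ), f z.1 z.2 =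
      ∑ᶠ κ : J → ℕ × ℕ, ∑ l ∈ Fintype.piFinset fun j => Finset.Iic (κ j), f l (κ - l) := by
  let g : (J → ℕ × ℕ) × (J → ℕ × ℕ) → E := fun z =>
    if z.2 ∈ Fintype.piFinset fun j => Finset.Iic (z.1 j) then f z.2 (z.1 - z.2) else 0
  let φ : (J → ℕ × ℕ) × (J → ℕ × ℕ) → (J → ℕ × ℕ) × (J → ℕ × ℕ) := fun z => (z.1 + z.2, z.1)
  have hφ : Function.Injective φ := by
    rintro ⟨l, k⟩ ⟨l', k'⟩ h
    obtain ⟨h1, rfl⟩ : l + k = l' + k' ∧ l = l' := by simpa [φ] using h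
    rw [add_left_cancel h1]
  have hgφ : ∀ z, g (φ z) = f z.1 z.2 := by
    rintro ⟨l, k⟩
    have h : l ∈ Fintype.piFinset fun j => Finset.Iic ((l + k) j) :=
      Fintype.mem_piFinset.2 fun j => Finset.mem_Iic.2 le_self_add
    simp only [g, φ, if_pos h, add_tsub_cancel_left]
  have hg : ∀ z, g z ≠ 0 → ∃ z', φ z' = z := by
    rintro ⟨κ, l⟩ hz
    have hl := (ite_ne_right_iff.1 hz).1
    refine ⟨(l, κ - l), Prod.ext (add_tsub_cancel_of_le fun j => ?_) rfl⟩
    exact Finset.mem_Iic.1 (Fintype.mem_piFinset.1 hl j)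
  have hgfin : g.HasFiniteSupport := by
    refine (Set.Finite.image φ hf).subset fun z hz => ?_
    obtain ⟨z', rfl⟩ := hg z hz
    exact ⟨z', by rwa [Function.mem_support, hgφ] at hz, rfl⟩
  rw [← finsum_congr hgφ, finsum_comp_of_injective hφ g hg, finsum_curry g hgfin]
  refine finsum_congr fun κ => ?_
  rw [finsum_eq_sum_of_support_subset (s := Fintype.piFinset fun j => Finset.Iic (κ j))]
  · exact Finset.sum_congr rfl fun l hl => if_pos hl
  · exact fun l hl => (ite_ne_right_iff.1 hl).1

lemma totShift_add {P : Type*} [Fintype P] {n : ℕ} (src dst : P → Fin n) (hs hs' : P → Idx K)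
    (κ κ' : P → ℕ × ℕ) : totShift src dst (hs + hs') (κ + κ') =
      totShift src dst hs κ + totShift src dst hs' κ' := by
  rw [totShift, totShift, totShift, ← Finset.sum_add_distrib]
  refine Finset.sum_congr rfl fun p _ => ?_
  rw [Pi.add_apply, Pi.add_apply, natIdx_add, add_sub_add_comm, Pi.single_add, Pi.single_add]
  abel

lemma binMul_merge {J : Type*} [Fintype J] {n : ℕ} (src dst : J → Fin n) (hs hs' : J → Idx K)
    (c : DistN K E n) (m : Fin n → Idx K)
    (hfin : {κ : J → ℕ × ℕ | c (m + totShift src dst (hs + hs') κ) ≠ 0}.Finite) :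
    binMul (Sum.elim src src) (Sum.elim dst dst) (Sum.elim hs hs') c m =
      binMul src dst (hs + hs') c m := by
  rw [binMul, ← finsum_comp_equiv (Equiv.sumArrowEquivProdArrow J J (ℕ × ℕ)).symm]
  have h1 : ∀ z : (J → ℕ × ℕ) × (J → ℕ × ℕ),
      (∏ p, binCoef₂ (Sum.elim hs hs' p) ((Equiv.sumArrowEquivProdArrow J J (ℕ × ℕ)).symm z p)) •
        c (m + totShift (Sum.elim src src) (Sum.elim dst dst) (Sum.elim hs hs')
          ((Equiv.sumArrowEquivProdArrow J J (ℕ × ℕ)).symm z)) =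
      ((∏ p, binCoef₂ (hs p) (z.1 p)) * ∏ p, binCoef₂ (hs' p) (z.2 p)) •
        c (m + totShift src dst (hs + hs') (z.1 + z.2)) := fun z => by
    rw [totShift_add, ← totShift_sumElim, Fintype.prod_sum_type]
    rfl
  rw [finsum_congr h1, finsum_add_fiberwise (fun l k =>
    ((∏ p, binCoef₂ (hs p) (l p)) * ∏ p, binCoef₂ (hs' p) (k p)) •
        c (m + totShift src dst (hs + hs') (l + k)))]
  · refine finsum_congr fun κ => ?_
    have h2 : ∀ l ∈ Fintype.piFinset fun j => Finset.Iic (κ j), l + (κ - l) = κ := fun l hl =>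
      add_tsub_cancel_of_le fun j => Finset.mem_Iic.1 (Fintype.mem_piFinset.1 hl j)
    rw [Finset.sum_congr rfl fun l hl => by rw [h2 l hl], ← Finset.sum_smul]
    congr 1
    simp only [Pi.add_apply, binCoef₂_add, Finset.prod_univ_sum, ← Finset.prod_mul_distrib]
    rfl
  · refine (hfin.biUnion fun κ _ => (Set.finite_Iic κ).prod (Set.finite_Iic κ)).subset ?_
    rintro ⟨l, k⟩ hz
    exact Set.mem_biUnion (right_ne_zero_of_smul hz)
      ⟨show l ≤ l + k from le_self_add, show k ≤ l + k from le_add_self⟩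

lemma flipFst_sumElim {P Q : Type*} {n : ℕ} (a b : P → Fin n) (a' b' : Q → Fin n) (fl : P → Bool)
    (fl' : Q → Bool) : flipFst (Sum.elim a a') (Sum.elim b b') (Sum.elim fl fl') =
      Sum.elim (flipFst a b fl) (flipFst a' b' fl') := by
  funext p
  cases p <;> rfl

lemma flipSign_sumElim {P Q : Type*} [Fintype P] [Fintype Q] (fl : P → Bool) (fl' : Q → Bool)
    (hs : P → Idx K) (hs' : Q → Idx K) :
    flipSign (Sum.elim fl fl') (Sum.elim hs hs') = flipSign fl hs * flipSign fl' hs' := by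
  rw [flipSign, Fintype.prod_sum_type]
  rfl

lemma flipMul_sumElim {P Q : Type*} [Fintype P] [Fintype Q] {n : ℕ} (a b : P → Fin n)
    (a' b' : Q → Fin n) (fl : P → Bool) (fl' : Q → Bool) (hs : P → Idx K) (hs' : Q → Idx K)
    (c : DistN K E n) (m : Fin n → Idx K)
    (hfin : {κ | c (m + totShift (flipFst (Sum.elim a a') (Sum.elim b b') (Sum.elim fl fl'))
      (flipFst (Sum.elim b b') (Sum.elim a a') (Sum.elim fl fl'))
        (Sum.elim hs hs') κ) ≠ 0}.Finite) :
    flipMul (Sum.elim a a') (Sum.elim b b') (Sum.elim fl fl') (Sum.elim hs hs') c m =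
      flipMul a b fl hs (flipMul a' b' fl' hs' c) m := by
  rw [flipFst_sumElim, flipFst_sumElim] at hfin
  rw [flipMul, flipFst_sumElim, flipFst_sumElim, binMul_sumElim _ _ _ _ _ _ _ _ hfin,
    flipSign_sumElim, mul_smul, flipMul, binMul, binMul, smul_finsum]
  congr 1
  refine finsum_congr fun κ => ?_
  rw [flipMul, smul_comm]

lemma flipSign_add {P : Type*} [Fintype P] (fl : P → Bool) {hs hs' : P → Idx K}
    (hK : ∀ p, Kbar K (hs p)) (hK' : ∀ p, Kbar K (hs' p)) :
    flipSign fl (hs + hs') = flipSign fl hs * flipSign fl hs' := by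
  rw [flipSign, flipSign, flipSign, ← Finset.prod_mul_distrib]
  refine Finset.prod_congr rfl fun p _ => ?_
  split_ifs
  · rw [← negOnePow_add (hK p) (hK' p), Pi.add_apply, Prod.fst_add, Prod.snd_add,
      add_sub_add_comm]
  · rw [one_mul]

lemma flipFst_comp {P : Type*} {n k : ℕ} (f : Fin n → Fin k) (a b : P → Fin n) (fl : P → Bool) :
    flipFst (f ∘ a) (f ∘ b) fl = f ∘ flipFst a b fl :=
  funext fun _ => (apply_ite f _ _ _).symm

lemma flipMul_merge {J Q : Type*} [Fintype J] [Fintype Q] {n : ℕ} (a b : J → Fin n)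
    (a' b' : Q → Fin n) (fl : J → Bool) (fl' : Q → Bool) (hs hs' : J → Idx K) (hs'' : Q → Idx K)
    (hK : ∀ p, Kbar K (hs p)) (hK' : ∀ p, Kbar K (hs' p)) (c : DistN K E n) (m : Fin n → Idx K)
    (hfin : {κ | c (m + totShift
      (flipFst (Sum.elim (Sum.elim a a) a') (Sum.elim (Sum.elim b b) b')
        (Sum.elim (Sum.elim fl fl) fl'))
      (flipFst (Sum.elim (Sum.elim b b) b') (Sum.elim (Sum.elim a a) a')
        (Sum.elim (Sum.elim fl fl) fl')) (Sum.elim (Sum.elim hs hs') hs'') κ) ≠ 0}.Finite)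
    (hfin' : {κ | c (m + totShift (flipFst (Sum.elim a a') (Sum.elim b b') (Sum.elim fl fl'))
      (flipFst (Sum.elim b b') (Sum.elim a a') (Sum.elim fl fl'))
        (Sum.elim (hs + hs') hs'') κ) ≠ 0}.Finite) :
    flipMul (Sum.elim (Sum.elim a a) a') (Sum.elim (Sum.elim b b) b')
        (Sum.elim (Sum.elim fl fl) fl') (Sum.elim (Sum.elim hs hs') hs'') c m =
      flipMul (Sum.elim a a') (Sum.elim b b') (Sum.elim fl fl') (Sum.elim (hs + hs') hs'') c m := by
  rw [flipMul_sumElim _ _ _ _ _ _ _ _ _ _ hfin, flipMul_sumElim _ _ _ _ _ _ _ _ _ _ hfin',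
    flipMul, flipFst_sumElim, flipFst_sumElim, binMul_merge, flipSign_sumElim,
    ← flipSign_add _ hK hK']
  · rfl
  · refine (hfin'.image (· ∘ Sum.inl)).subset fun κ hκ => ?_
    obtain ⟨κ', hκ'⟩ : ∃ κ', c (m + totShift (flipFst a b fl) (flipFst b a fl) (hs + hs') κ +
        totShift (flipFst a' b' fl') (flipFst b' a' fl') hs'' κ') ≠ 0 := by
      by_contra! h
      exact hκ (by simp [flipMul, binMul, h])
    refine ⟨Sum.elim κ κ', ?_, rfl⟩
    change c _ ≠ 0
    rwa [flipFst_sumElim, flipFst_sumElim, totShift_sumElim, ← add_assoc]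

lemma flipMul_unit {r : ℕ} (h : Idx K) (c : DistN K E (r + 2)) (m : Fin (r + 2) → Idx K) :
    flipMul (fun _ : Unit => 0) (fun _ => 1) (fun _ => false) (fun _ => h) c m =
      zwPow K E h (slice c fun j => m j.succ.succ) (m 0) (m 1) := by
  rw [flipMul, binMul, ← finsum_comp_equiv (Equiv.funUnique Unit (ℕ × ℕ)).symm]
  simp only [flipSign, Bool.false_eq_true, if_false, Finset.prod_const_one, one_smul]
  refine finsum_congr fun k => ?_
  congr 1
  · simp only [Equiv.funUnique_symm_apply, Finset.univ_unique, Finset.prod_singleton, binCoef₂,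
      binCoef]
    rw [pow_add, uniqueElim_const]
    ring
  · refine congrArg c ?_
    funext i
    simp only [totShift, flipFst, Bool.false_eq_true, if_false, Finset.univ_unique,
      Finset.sum_singleton, Equiv.funUnique_symm_apply, uniqueElim_const]
    refine Fin.cases ?_ (fun i => Fin.cases ?_ (fun i => ?_) i) i
    · simp [join_zero, natIdx, Prod.ext_iff, add_sub_assoc]
    · simp [join_one, natIdx, Prod.ext_iff]
    · simp [join_succ_succ, Fin.ext_iff]

end Merging

section PairIndices

variable {K : Type*} [Field K] [CharZero K] {E : Type*} [AddCommGroup E] [Module K E] {r : ℕ}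

/-- the pairs `(a p, b p)` whose order is reversed by `σ` -/
def flipAt {P : Type*} {n : ℕ} (σ : Equiv.Perm (Fin n)) (a b : P → Fin n) (p : P) : Bool :=
  decide (σ.symm (b p) < σ.symm (a p))

lemma symm_flipFst_lt {P : Type*} {n k : ℕ} (σ : Equiv.Perm (Fin n)) (f : Fin k → Fin n)
    (a b : P → Fin k) (hab : ∀ p, f (a p) ≠ f (b p)) (p : P) :
    σ.symm (f (flipFst a b (flipAt σ (f ∘ a) (f ∘ b)) p)) <
      σ.symm (f (flipFst b a (flipAt σ (f ∘ a) (f ∘ b)) p)) := by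
  simp only [flipFst, flipAt, decide_eq_true_eq, Function.comp_apply]
  split_ifs with h
  · exact h
  · exact lt_of_le_of_ne (not_lt.1 h) fun h' => hab p (σ.symm.injective h')

lemma finite_exponents_flip {P : Type*} [Fintype P] {n k : ℕ} (σ : Equiv.Perm (Fin n))
    (f : Fin k → Fin n) (a b : P → Fin k) (hab : ∀ p, f (a p) ≠ f (b p)) (hs : P → Idx K)
    {c : DistN K E k} (hc : InLatN K E c) (m : Fin k → Idx K) :
    {κ | c (m + totShift (flipFst a b (flipAt σ (f ∘ a) (f ∘ b)))
      (flipFst b a (flipAt σ (f ∘ a) (f ∘ b))) hs κ) ≠ 0}.Finite :=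
  finite_exponents _ _ (fun i => σ.symm (f i)) (fun p => symm_flipFst_lt σ f a b hab p) hs hc m

/-- the first components of the pairs `i < j` in `Fin (r + 1)` -/
def consFst : Fin r ⊕ Pairs r → Fin (r + 1) := Sum.elim (fun _ => 0) fun p => p.1.1.succ

/-- the second components of the pairs `i < j` in `Fin (r + 1)` -/
def consSnd : Fin r ⊕ Pairs r → Fin (r + 1) := Sum.elim Fin.succ fun p => p.1.2.succ

lemma consFst_lt (q : Fin r ⊕ Pairs r) : consFst q < consSnd q := by
  rcases q with j | p
  · exact j.succ_pos
  · exact Fin.succ_lt_succ_iff.2 p.2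

/-- the pairs `i < j` in `Fin (r + 1)`, according to whether `i = 0` -/
def consPairs : Fin r ⊕ Pairs r ≃ Pairs (r + 1) :=
  Equiv.ofBijective (fun q => ⟨(consFst q, consSnd q), consFst_lt q⟩) (by
    constructor
    · rintro (j | ⟨⟨i, j⟩, h⟩) (j' | ⟨⟨i', j'⟩, h'⟩) h'' <;>
        simp [consFst, consSnd, Fin.ext_iff] at h'' ⊢ <;> exact h''
    · rintro ⟨⟨i, j⟩, h⟩
      obtain ⟨j, rfl⟩ := Fin.exists_succ_eq.2 (Fin.pos_iff_ne_zero.1 (i.zero_le.trans_lt h))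
      obtain rfl | ⟨i, rfl⟩ := Fin.eq_zero_or_eq_succ i
      · exact ⟨Sum.inl j, rfl⟩
      · exact ⟨Sum.inr ⟨(i, j), Fin.succ_lt_succ_iff.1 h⟩, rfl⟩)

/-- the first components of the pairs `i < j` other than `(0, 1)` in `Fin (r + 2)` -/
def pairFst : (Fin r ⊕ Fin r) ⊕ Pairs r → Fin (r + 2) :=
  Sum.elim (Sum.elim (fun _ => 0) fun _ => 1) fun p => p.1.1.succ.succ

/-- the second components of the pairs `i < j` other than `(0, 1)` in `Fin (r + 2)` -/
def pairSnd : (Fin r ⊕ Fin r) ⊕ Pairs r → Fin (r + 2) :=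
  Sum.elim (Sum.elim (fun j => j.succ.succ) fun j => j.succ.succ) fun p => p.1.2.succ.succ

lemma collapse_comp_pairFst : collapse ∘ pairFst (r := r) =
    Sum.elim (Sum.elim (fun _ => 0) fun _ => 0) fun p => p.1.1.succ := by
  funext p
  rcases p with (_ | _) | _ <;> rfl

lemma collapse_comp_pairSnd : collapse ∘ pairSnd (r := r) =
    Sum.elim (Sum.elim Fin.succ Fin.succ) fun p => p.1.2.succ := by
  funext p
  rcases p with (_ | _) | _ <;> rfl

lemma collapse_pairFst_lt (p : (Fin r ⊕ Fin r) ⊕ Pairs r) :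
    collapse (pairFst p) < collapse (pairSnd p) := by
  rcases p with (j | j) | p
  · exact j.succ_pos
  · exact j.succ_pos
  · exact Fin.succ_lt_succ_iff.2 p.2

lemma pairFst_lt (p : (Fin r ⊕ Fin r) ⊕ Pairs r) : pairFst p < pairSnd p := by
  rcases p with (j | j) | p
  · exact j.succ.succ_pos
  · exact Fin.succ_lt_succ_iff.2 j.succ_pos
  · exact Fin.succ_lt_succ_iff.2 (Fin.succ_lt_succ_iff.2 p.2)

/-- the pairs `i < j` in `Fin (r + 2)` -/
def consConsPairs : Unit ⊕ ((Fin r ⊕ Fin r) ⊕ Pairs r) ≃ Pairs (r + 2) :=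
  Equiv.ofBijective (Sum.elim (fun _ => ⟨(0, 1), Fin.zero_lt_one⟩)
    fun p => ⟨(pairFst p, pairSnd p), pairFst_lt p⟩) (by
    constructor
    · rintro (_ | (j | j) | ⟨⟨i, j⟩, h⟩) (_ | (j' | j') | ⟨⟨i', j'⟩, h'⟩) h'' <;>
        simp [pairFst, pairSnd, Fin.ext_iff] at h'' ⊢ <;> exact h''
    · rintro ⟨⟨i, j⟩, h⟩
      obtain ⟨j, rfl⟩ := Fin.exists_succ_eq.2 (Fin.pos_iff_ne_zero.1 (i.zero_le.trans_lt h))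
      obtain rfl | ⟨i, rfl⟩ := Fin.eq_zero_or_eq_succ i
      · obtain rfl | ⟨j, rfl⟩ := Fin.eq_zero_or_eq_succ j
        · exact ⟨Sum.inl (), rfl⟩
        · exact ⟨Sum.inr (Sum.inl (Sum.inl j)), rfl⟩
      · have h' := Fin.succ_lt_succ_iff.1 h
        obtain ⟨j, rfl⟩ := Fin.exists_succ_eq.2 (Fin.pos_iff_ne_zero.1 (i.zero_le.trans_lt h'))
        obtain rfl | ⟨i, rfl⟩ := Fin.eq_zero_or_eq_succ i
        · exact ⟨Sum.inr (Sum.inl (Sum.inr j)), rfl⟩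
        · exact ⟨Sum.inr (Sum.inr ⟨(i, j), Fin.succ_lt_succ_iff.1 h'⟩), rfl⟩)

/-- multiplication by `∏_{i<j, (i,j)≠(0,1)} (𝐳_i - 𝐳_j)^{h_{ij}}`, expanded in the domain given by
an ordering of the variables in which the first two variables are identified -/
def restMul (σ : Equiv.Perm (Fin (r + 1))) (hs : (Fin r ⊕ Fin r) ⊕ Pairs r → Idx K)
    (c : DistN K E (r + 2)) : DistN K E (r + 2) :=
  flipMul pairFst pairSnd (flipAt σ (collapse ∘ pairFst) (collapse ∘ pairSnd)) hs c

lemma permMul_eq_zwPow (σ : Equiv.Perm (Fin (r + 2))) (τ : Equiv.Perm (Fin (r + 1)))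
    (h01 : σ.symm 0 < σ.symm 1)
    (hστ : ∀ i j, collapse i ≠ collapse j →
      (σ.symm i < σ.symm j ↔ τ.symm (collapse i) < τ.symm (collapse j)))
    (hs : Pairs (r + 2) → Idx K) {c : DistN K E (r + 2)} (hc : InLatN K E c)
    (m : Fin (r + 2) → Idx K) :
    permMul K E σ hs c m = zwPow K E (hs (consConsPairs (Sum.inl ())))
      (slice (restMul τ (hs ∘ consConsPairs ∘ Sum.inr) c) fun j => m j.succ.succ) (m 0) (m 1) := by
  have hfst : (fun p : Pairs (r + 2) => p.1.1) ∘ consConsPairs =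
      Sum.elim (fun _ => 0) pairFst := by
    funext p
    rcases p with _ | _ <;> rfl
  have hsnd : (fun p : Pairs (r + 2) => p.1.2) ∘ consConsPairs =
      Sum.elim (fun _ => 1) pairSnd := by
    funext p
    rcases p with _ | _ <;> rfl
  have hflip : flipOf σ ∘ consConsPairs =
      Sum.elim (fun _ => false) (flipAt τ (collapse ∘ pairFst) (collapse ∘ pairSnd)) := by
    funext p
    rcases p with _ | p
    · exact decide_eq_false (not_lt.2 h01.le)
    · exact decide_eq_decide.2 (hστ _ _ (collapse_pairFst_lt p).ne')
  have hflip' : flipOf σ ∘ consConsPairs =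
      flipAt σ (id ∘ Sum.elim (fun _ : Unit => 0) pairFst)
        (id ∘ Sum.elim (fun _ => 1) pairSnd) := by
    rw [← hfst, ← hsnd]
    rfl
  have hhs : hs ∘ consConsPairs = Sum.elim (fun _ => hs (consConsPairs (Sum.inl ())))
      (hs ∘ consConsPairs ∘ Sum.inr) := by
    funext p
    rcases p with _ | _ <;> rfl
  rw [permMul_eq, ← flipMul_comp_equiv consConsPairs, hfst, hsnd, hflip, hhs, flipMul_sumElim,
    flipMul_unit]
  · rfl
  · rw [← hflip, hflip']
    refine finite_exponents_flip σ id _ _ (fun p => ?_) _ hc m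
    rcases p with _ | p
    · exact Fin.zero_ne_one
    · exact (pairFst_lt p).ne

lemma inLat2_slice_restMul (σ : Equiv.Perm (Fin (r + 1)))
    (hs : (Fin r ⊕ Fin r) ⊕ Pairs r → Idx K) {c : DistN K E (r + 2)} (hc : InLatN K E c)
    (t : Fin r → Idx K) : InLat2 K E (slice (restMul σ hs c) t) := by
  let fl := flipAt σ (collapse ∘ pairFst) (collapse ∘ pairSnd (r := r))
  have hlt := symm_flipFst_lt σ collapse pairFst (pairSnd (r := r)) fun p =>
    (collapse_pairFst_lt p).ne
  obtain ⟨S, hS⟩ := inLat2_slice_binMul (flipFst pairFst pairSnd fl) (flipFst pairSnd pairFst fl)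
    (fun i => (σ.symm (collapse i) : ℕ) - σ.symm 0)
    (fun p => Nat.sub_le_sub_right (hlt p).le _) (Nat.sub_self _) (Nat.sub_self _)
    (fun p hp => by
      refine Nat.sub_pos_of_lt ((hlt p).trans_le' (le_of_eq ?_))
      rcases hp with h | h <;> exact congrArg (fun i => σ.symm (collapse i)) h.symm) hs hc t
  exact ⟨S, fun x y hxy => hS x y (right_ne_zero_of_smul hxy)⟩

lemma diagN_restMul (σ : Equiv.Perm (Fin (r + 1))) (hs : (Fin r ⊕ Fin r) ⊕ Pairs r → Idx K)
    (hK : ∀ p, Kbar K (hs p)) {c : DistN K E (r + 2)} (hc : InLatN K E c)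
    (m : Fin (r + 1) → Idx K) :
    diagN (restMul σ hs c) m = permMul K E σ
      (Sum.elim (fun j => hs (Sum.inl (Sum.inl j)) + hs (Sum.inl (Sum.inr j)))
        (fun p => hs (Sum.inr p)) ∘ consPairs.symm) (diagN c) m := by
  have hab : ∀ p : (Fin r ⊕ Fin r) ⊕ Pairs r, collapse (pairFst p) ≠ collapse (pairSnd p) :=
    fun p => (collapse_pairFst_lt p).ne
  have h1 : diagN (restMul σ hs c) m = flipMul (collapse ∘ pairFst) (collapse ∘ pairSnd)
      (flipAt σ (collapse ∘ pairFst) (collapse ∘ pairSnd)) hs (diagN c) m := by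
    have h := diagN_binMul _ _ (fun i => (σ.symm i : ℕ))
      (fun p => symm_flipFst_lt σ collapse _ _ hab p) hs hc m
    rw [flipMul, flipFst_comp, flipFst_comp, ← h, diagN_apply, diagN_apply, smul_finsum]
    rfl
  have h2 : flipAt σ (collapse ∘ pairFst) (collapse ∘ pairSnd) = Sum.elim
      (Sum.elim (fun j => flipAt σ consFst consSnd (Sum.inl j))
        fun j => flipAt σ consFst consSnd (Sum.inl j))
      fun p => flipAt σ consFst consSnd (Sum.inr p) := by
    funext p
    rcases p with (_ | _) | _ <;> rfl
  have h3 : hs = Sum.elim (Sum.elim (fun j => hs (Sum.inl (Sum.inl j)))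
      fun j => hs (Sum.inl (Sum.inr j))) fun p => hs (Sum.inr p) := by
    funext p
    rcases p with (_ | _) | _ <;> rfl
  have h4 : Sum.elim (fun j => flipAt σ consFst consSnd (Sum.inl j))
      (fun p => flipAt σ consFst consSnd (Sum.inr p)) = flipAt σ consFst (consSnd (r := r)) := by
    funext p
    rcases p with _ | _ <;> rfl
  have hfin := finite_exponents_flip σ id (collapse ∘ pairFst) (collapse ∘ pairSnd) hab hs
    (inLatN_diagN hc) m
  rw [Function.id_comp, Function.id_comp, h2, h3, collapse_comp_pairFst,
    collapse_comp_pairSnd] at hfin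
  rw [h1, h2, h3, collapse_comp_pairFst, collapse_comp_pairSnd,
    flipMul_merge _ _ _ _ _ _ _ _ _ (fun j => hK _) (fun j => hK _) _ _ hfin, permMul_eq,
    ← flipMul_comp_equiv consPairs, h4, Function.comp_assoc, Equiv.symm_comp_self]
  · rfl
  · rw [h4]
    exact finite_exponents_flip σ id consFst consSnd (fun q => (consFst_lt q).ne) _
      (inLatN_diagN hc) m

end PairIndices

section Spans

variable {K : Type*} [Field K] [CharZero K] {E : Type*} [AddCommGroup E] [Module K E] {r : ℕ}

lemma Kbar.neg {h : Idx K} (hh : Kbar K h) : Kbar K (-h) := by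
  obtain ⟨k, hk⟩ := hh
  exact ⟨-k, by rw [Int.cast_neg, hk, Prod.fst_neg, Prod.snd_neg]; ring⟩

/-- the family of all products `∏_{i<j} ((𝐳_i - 𝐳_j)_σ)^{h_{ij}} c(𝐳₁, …, 𝐳ᵣ) v` -/
def permFam (hs : Pairs r → Idx K) (c : EDistN K E r) : Equiv.Perm (Fin r) → E → DistN K E r :=
  fun σ v => permMul K E σ hs (evN K E c v)

/-- the span of the families `permFam hs c` for exponents in `𝕂̄` and fields `c` -/
def permSpan (K : Type*) [Field K] [CharZero K] (E : Type*) [AddCommGroup E] [Module K E] (r : ℕ) :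
    Submodule K (Equiv.Perm (Fin r) → E → DistN K E r) :=
  Submodule.span K {F | ∃ (hs : Pairs r → Idx K) (c : EDistN K E r), (∀ p, Kbar K (hs p)) ∧
    (∀ v, InLatN K E (evN K E c v)) ∧ permFam hs c = F}

/-- the family of all products `restMul σ hs (c v)` -/
def restFam (hs : (Fin r ⊕ Fin r) ⊕ Pairs r → Idx K) (c : EDistN K E (r + 2)) :
    Equiv.Perm (Fin (r + 1)) → E → DistN K E (r + 2) :=
  fun σ v => restMul σ hs (evN K E c v)

/-- the span of the families `restFam hs c` for exponents in `𝕂̄` and fields `c` -/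
def restSpan (K : Type*) [Field K] [CharZero K] (E : Type*) [AddCommGroup E] [Module K E] (r : ℕ) :
    Submodule K (Equiv.Perm (Fin (r + 1)) → E → DistN K E (r + 2)) :=
  Submodule.span K {F | ∃ (hs : (Fin r ⊕ Fin r) ⊕ Pairs r → Idx K) (c : EDistN K E (r + 2)),
    (∀ p, Kbar K (hs p)) ∧ (∀ v, InLatN K E (evN K E c v)) ∧ restFam hs c = F}

lemma restFam_mem {hs : (Fin r ⊕ Fin r) ⊕ Pairs r → Idx K} {c : EDistN K E (r + 2)}
    (hK : ∀ p, Kbar K (hs p)) (hc : ∀ v, InLatN K E (evN K E c v)) :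
    restFam hs c ∈ restSpan K E r :=
  Submodule.subset_span ⟨hs, c, hK, hc, rfl⟩

lemma inLatN_derivN (pr : Idx K →+ K) (u : ℕ × ℕ) {n : ℕ} (i : Fin n) {c : DistN K E n}
    (hc : InLatN K E c) : InLatN K E (derivN pr u i c) := by
  obtain ⟨S, hS⟩ := hc
  refine ⟨S.image (· + Pi.single i (natIdx u)), fun m hm => ?_⟩
  obtain ⟨s, hs, h⟩ := hS _ (right_ne_zero_of_smul hm)
  refine ⟨_, Finset.mem_image_of_mem _ hs, fun j => ?_⟩
  have hj := h j
  simp only [Pi.sub_apply, Pi.add_apply, Prod.fst_sub, Prod.snd_sub, Prod.fst_add,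
    Prod.snd_add] at hj ⊢
  rwa [sub_add_eq_sub_sub_swap, sub_add_eq_sub_sub_swap]

/-- the derivative with respect to the first variable, for families -/
def derivFam (pr : Idx K →+ K) (u : ℕ × ℕ) :
    (Equiv.Perm (Fin (r + 1)) → E → DistN K E (r + 2)) →ₗ[K]
      (Equiv.Perm (Fin (r + 1)) → E → DistN K E (r + 2)) where
  toFun F := fun σ v => derivN pr u 0 (F σ v)
  map_add' F G := by
    funext σ v m
    exact smul_add _ _ _
  map_smul' x F := by
    funext σ v m
    exact smul_comm _ _ _

lemma IsCoord.derivFam_mem {pr : Idx K →+ K} {u : ℕ × ℕ} (hu : IsCoord pr u)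
    {F : Equiv.Perm (Fin (r + 1)) → E → DistN K E (r + 2)} (hF : F ∈ restSpan K E r) :
    derivFam pr u F ∈ restSpan K E r := by
  have h : restSpan K E r ≤ (restSpan K E r).comap (derivFam pr u) := by
    refine Submodule.span_le.2 ?_
    rintro _ ⟨hs, c, hK, hc, rfl⟩
    have key : derivFam pr u (restFam hs c) = restFam hs (derivN pr u 0 c) +
        ∑ p, (((if pairFst p = 0 then 1 else 0) - (if pairSnd p = 0 then 1 else 0)) * pr (hs p)) •
          restFam (hs - Pi.single p (natIdx u)) c := by
      funext σ v m
      simp only [Pi.add_apply, Finset.sum_apply, Pi.smul_apply]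
      convert hu.derivN_flipMul _ _ _ hs hK _ 0 (finite_exponents_flip σ collapse _ _
        (fun p => (collapse_pairFst_lt p).ne) hs (hc v)) m
      · rfl
      · rfl
      · unfold restFam restMul
        congr!
    rw [SetLike.mem_coe, Submodule.mem_comap, key]
    refine add_mem (restFam_mem hK fun v => inLatN_derivN pr u 0 (hc v)) (sum_mem fun p _ =>
      Submodule.smul_mem _ _ (restFam_mem (fun q => ?_) hc))
    obtain rfl | hq := eq_or_ne q p
    · rw [Pi.sub_apply, Pi.single_eq_same]
      exact hu.kbar_sub _ (hK q)
    · rw [Pi.sub_apply, Pi.single_eq_of_ne hq, sub_zero]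
      exact hK q
  exact h hF

section DividedPowers

variable {A B : Type*} [AddCommGroup A] [Module K A] [AddCommGroup B] [Module K B]

lemma dPow_mem {d : A → A} {p : Submodule K A} (hd : ∀ a ∈ p, d a ∈ p) (x : K) {a : A}
    (ha : a ∈ p) : dPow K d x a ∈ p := by
  have h : ∀ j, d^[j] a ∈ p := fun j => by
    induction j with
    | zero => exact ha
    | succ j ih =>
      rw [Function.iterate_succ_apply']
      exact hd _ ih
  rw [dPow]
  split_ifs
  · exact p.smul_mem _ (h _)
  · exact p.zero_mem

lemma map_dPow {d : A → A} {d' : B → B} (f : A →ₗ[K] B) (hf : Function.Semiconj f d d') (x : K)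
    (a : A) : f (dPow K d x a) = dPow K d' x (f a) := by
  rw [dPow, dPow]
  split_ifs
  · rw [map_smul, (hf.iterate_right _).eq]
  · exact map_zero f

end DividedPowers

/-- the divided power `∂_z^{(e₁)} ∂_z̄^{(e₂)}` in the first variable pair, for families -/
def ddFam (e : Idx K) (F : Equiv.Perm (Fin (r + 1)) → E → DistN K E (r + 2)) :
    Equiv.Perm (Fin (r + 1)) → E → DistN K E (r + 2) :=
  dPow K (derivFam (AddMonoidHom.fst K K) (1, 0)) e.1
    (dPow K (derivFam (AddMonoidHom.snd K K) (0, 1)) e.2 F)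

lemma ddFam_mem (e : Idx K) {F : Equiv.Perm (Fin (r + 1)) → E → DistN K E (r + 2)}
    (hF : F ∈ restSpan K E r) : ddFam e F ∈ restSpan K E r :=
  dPow_mem (fun _ => isCoord_fst.derivFam_mem) _ (dPow_mem (fun _ => isCoord_snd.derivFam_mem) _ hF)

lemma slice_ddFam (e : Idx K) (F : Equiv.Perm (Fin (r + 1)) → E → DistN K E (r + 2))
    (σ : Equiv.Perm (Fin (r + 1))) (v : E) (t : Fin r → Idx K) :
    slice (ddFam e F σ v) t = ddPow2 K E e (slice (F σ v) t) := by
  let f : (Equiv.Perm (Fin (r + 1)) → E → DistN K E (r + 2)) →ₗ[K] Dist2 K E :=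
    { toFun := fun F => slice (F σ v) t
      map_add' := fun _ _ => rfl
      map_smul' := fun _ _ => rfl }
  have hj : ∀ x y z : Idx K, join x y t - Pi.single 0 z = join (x - z) y t := fun x y z => by
    funext i
    refine Fin.cases ?_ (fun i => ?_) i
    · simp [join]
    · simp [join]
  have h1 : Function.Semiconj f (derivFam (AddMonoidHom.fst K K) (1, 0)) (d1z K E) := fun F => by
    funext x y
    change (-x.1) • F σ v (join x y t - Pi.single 0 _) = (-x.1) • F σ v (join _ y t)
    rw [hj]
    congr 3
    ext <;> simp [natIdx]
  have h2 : Function.Semiconj f (derivFam (AddMonoidHom.snd K K) (0, 1)) (d1zb K E) := fun F => by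
    funext x y
    change (-x.2) • F σ v (join x y t - Pi.single 0 _) = (-x.2) • F σ v (join _ y t)
    rw [hj]
    congr 3
    ext <;> simp [natIdx]
  change f (ddFam e F) = _
  rw [ddFam, map_dPow f h1, map_dPow f h2]
  rfl

lemma diagN_mem_permSpan {F : Equiv.Perm (Fin (r + 1)) → E → DistN K E (r + 2)}
    (hF : F ∈ restSpan K E r) :
    (∀ σ v m, {x | F σ v (antidiag m x) ≠ 0}.Finite) ∧
      (fun σ v m => diagN (F σ v) m) ∈ permSpan K E (r + 1) := by
  induction hF using Submodule.span_induction with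
  | mem F hF =>
    obtain ⟨hs, c, hK, hc, rfl⟩ := hF
    refine ⟨fun σ v m => ?_, Submodule.subset_span ⟨Sum.elim
      (fun j => hs (Sum.inl (Sum.inl j)) + hs (Sum.inl (Sum.inr j)))
        (fun p => hs (Sum.inr p)) ∘ consPairs.symm, fun m =>
      { toFun := fun v => diagN (evN K E c v) m
        map_add' := fun v w => ?_
        map_smul' := fun x v => ?_ }, fun p => ?_, fun v => inLatN_diagN (hc v), ?_⟩⟩
    · refine (((inLat2_slice_restMul σ hs (hc v) (Fin.tail m)).finite_antidiagonal
        (m 0 - 1)).preimage ((sub_right_injective (b := m 0 - 1)).injOn)).subset fun x hx => ?_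
      simp only [Set.mem_preimage, Set.mem_ofPred_eq, sub_sub_cancel]
      rwa [sub_right_comm]
    · simp only [diagN_apply]
      rw [← finsum_add_distrib (finite_antidiag (hc v) m) (finite_antidiag (hc w) m)]
      exact finsum_congr fun y => map_add (c _) v w
    · simp only [diagN_apply]
      rw [RingHom.id_apply, smul_finsum]
      exact finsum_congr fun y => map_smul (c _) x v
    · rcases h : consPairs.symm p with j | q
      · rw [Function.comp_apply, h, Sum.elim_inl]
        obtain ⟨k, hk⟩ := hK (Sum.inl (Sum.inl j))
        obtain ⟨l, hl⟩ := hK (Sum.inl (Sum.inr j))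
        exact ⟨k + l, by rw [Prod.fst_add, Prod.snd_add, Int.cast_add, hk, hl]; ring⟩
      · rw [Function.comp_apply, h]
        exact hK _
    · funext σ v m
      exact (diagN_restMul σ hs hK (hc v) m).symm
  | zero =>
    refine ⟨fun σ v m => by simp, ?_⟩
    convert (permSpan K E (r + 1)).zero_mem
    rename_i σ v m
    simp [diagN_apply]
  | add F G _ _ hF hG =>
    refine ⟨fun σ v m => ((hF.1 σ v m).union (hG.1 σ v m)).subset fun x hx => ?_, ?_⟩
    · by_contra h
      simp only [Set.mem_union, Set.mem_ofPred_eq, not_or, not_not] at h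
      exact hx (by simp [h])
    · convert add_mem hF.2 hG.2
      rename_i σ v m
      exact finsum_add_distrib (hF.1 σ v m) (hG.1 σ v m)
  | smul k F _ hF =>
    refine ⟨fun σ v m => (hF.1 σ v m).subset fun x (hx : k • _ ≠ 0) =>
      right_ne_zero_of_smul hx, ?_⟩
    convert (permSpan K E (r + 1)).smul_mem k hF.2
    rename_i σ v m
    exact (smul_finsum _ _).symm

lemma inLatN_sum {ι : Type*} [Fintype ι] {c : ι → DistN K E r} (hc : ∀ i, InLatN K E (c i)) :
    InLatN K E (∑ i, c i) := by
  choose S hS using hc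
  refine ⟨Finset.univ.biUnion S, fun n hn => ?_⟩
  rw [Finset.sum_apply] at hn
  obtain ⟨i, -, hi⟩ := Finset.exists_ne_zero_of_sum_ne_zero hn
  obtain ⟨m, hm, h⟩ := hS i n hi
  exact ⟨m, Finset.mem_biUnion.2 ⟨i, Finset.mem_univ i, hm⟩, h⟩

lemma permMul_sum {ι : Type*} [Fintype ι] (σ : Equiv.Perm (Fin r)) (hs : Pairs r → Idx K)
    {c : ι → DistN K E r} (hc : ∀ i, InLatN K E (c i)) (m : Fin r → Idx K) :
    permMul K E σ hs (∑ i, c i) m = ∑ i, permMul K E σ hs (c i) m := by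
  simp only [permMul_eq, flipMul, binMul, Finset.sum_apply, Finset.smul_sum]
  rw [finsum_sum_comm, Finset.smul_sum]
  exact fun i _ => (finite_exponents_flip σ id (fun p : Pairs r => p.1.1) (fun p => p.1.2)
    (fun p => p.2.ne) hs (hc i) m).subset fun κ hκ => right_ne_zero_of_smul hκ

lemma exists_sum_permMul_eq {N : ℕ} (k : Fin N → K) (hs : Fin N → Pairs r → Idx K)
    {c : Fin N → EDistN K E r} (hc : ∀ f v, InLatN K E (evN K E (c f) v)) :
    ∃ d : (Pairs r → Fin N) → EDistN K E r, (∀ α v, InLatN K E (evN K E (d α) v)) ∧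
      ∀ σ v m, ∑ α, permMul K E σ (fun p => hs (α p) p) (evN K E (d α) v) m =
        ∑ f, k f • permFam (hs f) (c f) σ v m := by
  let d : Fin N → (Pairs r → Fin N) → EDistN K E r := fun f α =>
    if α = fun _ => f then k f • c f else 0
  have hd : ∀ f α v, InLatN K E (evN K E (d f α) v) := fun f α v => by
    obtain ⟨S, hS⟩ := hc f v
    refine ⟨S, fun n hn => hS n fun h0 => hn ?_⟩
    simp only [evN, d]
    split_ifs
    · exact (congrArg (k f • ·) h0).trans (smul_zero _)
    · rfl
  have hsum : ∀ α v, evN K E (∑ f, d f α) v = ∑ f, evN K E (d f α) v := fun α v => by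
    funext m
    simp only [evN, Finset.sum_apply, LinearMap.sum_apply]
  have hd' : ∀ σ v m f α, permMul K E σ (fun p => hs (α p) p) (evN K E (d f α) v) m =
      if α = fun _ => f then k f • permFam (hs f) (c f) σ v m else 0 := fun σ v m f α => by
    simp only [d]
    split_ifs with hα
    · rw [hα, permFam, permMul, permMul, smul_finsum]
      exact finsum_congr fun κ => smul_comm _ _ _
    · rw [permMul]
      exact (finsum_congr fun κ => smul_zero _).trans finsum_zero
  refine ⟨fun α => ∑ f, d f α, fun α v => ?_, fun σ v m => ?_⟩
  · rw [hsum]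
    exact inLatN_sum fun f => hd f α v
  · simp only [hsum]
    rw [Finset.sum_congr rfl fun α _ => permMul_sum σ _ (fun f => hd f α v) m, Finset.sum_comm]
    refine Finset.sum_congr rfl fun f _ => ?_
    rw [Finset.sum_congr rfl fun α _ => hd' σ v m f α, Finset.sum_ite_eq',
      if_pos (Finset.mem_univ _)]

lemma multiplyLocal_of_mem_permSpan {a : Fin r → EDist1 K E} {ps : Fin r → ZMod 2}
    (h : (fun σ v m => koszulPerm K ps σ • compSeq K E a σ m v) ∈ permSpan K E r) :
    MultiplyLocal K E a ps := by
  obtain ⟨N, k, g, hg⟩ := Submodule.mem_span_set'.1 h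
  choose hs c hK hc hF using fun i => (g i).2
  obtain ⟨d, hd, hd'⟩ := exists_sum_permMul_eq k hs hc
  refine ⟨fun _ _ => N, fun i j f => if hij : i < j then -hs f ⟨(i, j), hij⟩ else 0, d,
    fun i j f => ?_, hd, fun σ v m => ?_⟩
  · by_cases hij : i < j
    · simpa only [dif_pos hij] using (hK f ⟨(i, j), hij⟩).neg
    · exact ⟨0, by simp [dif_neg hij]⟩
  · have h1 := congrFun (congrFun (congrFun hg σ) v) m
    simp only [Finset.sum_apply, Pi.smul_apply, ← hF] at h1
    rw [← h1, ← hd']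
    refine Finset.sum_congr rfl fun α _ => ?_
    congr 1
    funext p
    simp only [dif_pos p.2, neg_neg, Prod.mk.eta, Subtype.coe_eta]

end Spans

section Lifting

variable {r : ℕ}

/-- the ordering of `r + 2` variables obtained from an ordering of `r + 1` variables by replacing
the first variable by two adjacent variables -/
def liftPerm (τ : Equiv.Perm (Fin (r + 1))) : Equiv.Perm (Fin (r + 2)) :=
  (finSuccEquiv' (τ.symm 0).succ).trans (τ.optionCongr.trans (finSuccEquiv' 1).symm)

lemma liftPerm_succ (τ : Equiv.Perm (Fin (r + 1))) : liftPerm τ (τ.symm 0).succ = 1 := by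
  simp [liftPerm]

lemma liftPerm_succAbove (τ : Equiv.Perm (Fin (r + 1))) (j : Fin (r + 1)) :
    liftPerm τ ((τ.symm 0).succ.succAbove j) = Fin.succAbove 1 (τ j) := by
  simp [liftPerm]

lemma one_succAbove_succ (j : Fin r) : Fin.succAbove (1 : Fin (r + 2)) j.succ = j.succ.succ :=
  Fin.succ_succAbove_succ 0 j

lemma collapse_succAbove (j : Fin (r + 1)) : collapse (Fin.succAbove 1 j) = j := by
  refine Fin.cases rfl (fun j => ?_) j
  rw [one_succAbove_succ]
  rfl

lemma predAbove_liftPerm_symm (τ : Equiv.Perm (Fin (r + 1))) (i : Fin (r + 2)) :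
    (τ.symm 0).predAbove ((liftPerm τ).symm i) = τ.symm (collapse i) := by
  obtain ⟨k, rfl⟩ := (liftPerm τ).surjective i
  rw [Equiv.symm_apply_apply]
  obtain rfl | ⟨j, rfl⟩ := Fin.eq_self_or_eq_succAbove (τ.symm 0).succ k
  · rw [liftPerm_succ, Fin.predAbove_succ_self]
    rfl
  · rw [liftPerm_succAbove, collapse_succAbove, Equiv.symm_apply_apply]
    rcases le_or_gt j (τ.symm 0) with h | h
    · rw [Fin.succAbove_of_castSucc_lt _ _ (Fin.castSucc_lt_succ_iff.2 h),
        Fin.predAbove_castSucc_of_le _ _ h]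
    · rw [Fin.succAbove_of_le_castSucc _ _ (Fin.succ_le_castSucc_iff.2 h),
        Fin.predAbove_succ_of_le _ _ h.le]

lemma liftPerm_symm_lt_iff (τ : Equiv.Perm (Fin (r + 1))) (i j : Fin (r + 2))
    (hij : collapse i ≠ collapse j) : (liftPerm τ).symm i < (liftPerm τ).symm j ↔
      τ.symm (collapse i) < τ.symm (collapse j) := by
  have hmono := Fin.predAbove_right_monotone (τ.symm 0)
  rw [← predAbove_liftPerm_symm, ← predAbove_liftPerm_symm]
  refine ⟨fun h => (hmono h.le).lt_of_ne ?_, hmono.reflect_lt⟩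
  rw [predAbove_liftPerm_symm, predAbove_liftPerm_symm]
  exact τ.symm.injective.ne hij

lemma liftPerm_symm_zero_lt (τ : Equiv.Perm (Fin (r + 1))) :
    (liftPerm τ).symm 0 < (liftPerm τ).symm 1 := by
  have h0 : (liftPerm τ).symm 0 = (τ.symm 0).castSucc := by
    have h := liftPerm_succAbove τ (τ.symm 0)
    rw [Fin.succAbove_succ_self, Equiv.apply_symm_apply] at h
    exact (liftPerm τ).symm_apply_eq.2 h.symm
  have h1 : (liftPerm τ).symm 1 = (τ.symm 0).succ :=
    (liftPerm τ).symm_apply_eq.2 (liftPerm_succ τ).symm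
  rw [h0, h1]
  exact Fin.castSucc_lt_succ

lemma exists_ofFn_eq_append {β : Type*} {n : ℕ} (f : Fin (n + 1) → β) (g : Fin (n + 2) → β)
    (p : Fin (n + 1)) (h : ∀ j, g (p.succ.succAbove j) = f j) :
    ∃ L₁ L₂, List.ofFn f = L₁ ++ f p :: L₂ ∧ List.ofFn g = L₁ ++ f p :: g p.succ :: L₂ := by
  induction n with
  | zero =>
    obtain rfl : p = 0 := Fin.fin_one_eq_zero p
    refine ⟨[], [], by simp, ?_⟩
    have h0 := h 0
    simp_all [List.ofFn_succ]
  | succ n ih =>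
    have h0 := h 0
    obtain rfl | ⟨q, rfl⟩ := Fin.eq_zero_or_eq_succ p
    · refine ⟨[], List.ofFn fun j => f j.succ, List.ofFn_succ, ?_⟩
      rw [List.ofFn_succ, List.ofFn_succ, ← h0]
      refine congrArg _ (congrArg _ (congrArg _ (funext fun j => ?_)))
      rw [← h, ← one_succAbove_succ]
      rfl
    · obtain ⟨L₁, L₂, h₁, h₂⟩ := ih (fun j => f j.succ) (fun j => g j.succ) q fun j => by
        rw [← h, ← Fin.succ_succAbove_succ]
      refine ⟨f 0 :: L₁, L₂, ?_, ?_⟩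
      · rw [List.ofFn_succ, h₁, List.cons_append]
      · rw [List.ofFn_succ, h₂, List.cons_append, ← h0]
        rfl

variable {K : Type*} [Field K] [CharZero K] {E : Type*} [AddCommGroup E] [Module K E]

lemma compSeq_eq_prod (a : Fin r → EDist1 K E) (σ : Equiv.Perm (Fin r)) (m : Fin r → Idx K)
    (v : E) : compSeq K E a σ m v = ((List.ofFn σ).map fun i => a i (m i)).prod v := by
  have h : ∀ l : List (Fin r), l.foldr (fun i acc => a i (m i) acc) v =
      (l.map fun i => a i (m i)).prod v := fun l => by
    induction l with
    | nil => rfl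
    | cons i l ih => rw [List.foldr_cons, ih, List.map_cons, List.prod_cons, Module.End.mul_apply]
  exact h _

lemma exists_compSeq_liftPerm (a : Fin (r + 2) → EDist1 K E) (τ : Equiv.Perm (Fin (r + 1)))
    (t : Fin r → Idx K) (v : E) : ∃ (A : Module.End K E) (w : E),
      (∀ x y, compSeq K E a (liftPerm τ) (join x y t) v = A (a 0 x (a 1 y w))) ∧
      ∀ (b : EDist1 K E) (x : Idx K), compSeq K E
        (Fin.cons b fun i : Fin r => a i.succ.succ : Fin (r + 1) → EDist1 K E) τ (Fin.cons x t) v =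
          A (b x w) := by
  obtain ⟨L₁, L₂, h₁, h₂⟩ := exists_ofFn_eq_append (fun j => Fin.succAbove 1 (τ j)) (liftPerm τ)
    (τ.symm 0) (liftPerm_succAbove τ)
  rw [Equiv.apply_symm_apply, Fin.one_succAbove_zero] at h₁ h₂
  rw [liftPerm_succ] at h₂
  have hnd : (L₁ ++ 0 :: 1 :: L₂).Nodup := by
    rw [← h₂, List.nodup_ofFn]
    exact (liftPerm τ).injective
  have hne : (∀ i ∈ L₁, i ≠ 0 ∧ i ≠ 1) ∧ ∀ i ∈ L₂, i ≠ 0 ∧ i ≠ 1 := by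
    simp only [List.nodup_append, List.nodup_cons, List.mem_cons, not_or] at hnd
    refine ⟨fun i hi => ⟨hnd.2.2 i hi 0 (Or.inl rfl), hnd.2.2 i hi 1 (Or.inr (Or.inl rfl))⟩,
      fun i hi => ⟨?_, ?_⟩⟩
    · rintro rfl
      exact hnd.2.1.1.2 hi
    · rintro rfl
      exact hnd.2.1.2.1 hi
  let ψ : Fin (r + 2) → Module.End K E := Fin.cons 0 (Fin.cons 0 fun j => a j.succ.succ (t j))
  have hψ : ∀ φ : Fin (r + 2) → Module.End K E, (∀ j : Fin r, φ j.succ.succ = a j.succ.succ (t j)) →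
      L₁.map φ = L₁.map ψ ∧ L₂.map φ = L₂.map ψ := fun φ hφ => by
    have h : ∀ i, i ≠ 0 ∧ i ≠ 1 → φ i = ψ i := fun i =>
      Fin.cases (fun hi => absurd rfl hi.1)
        (fun i => Fin.cases (fun hi => absurd rfl hi.2) (fun i _ => hφ i) i) i
    exact ⟨List.map_congr_left fun i hi => h i (hne.1 i hi),
      List.map_congr_left fun i hi => h i (hne.2 i hi)⟩
  refine ⟨(L₁.map ψ).prod, (L₂.map ψ).prod v, fun x y => ?_, fun b x => ?_⟩
  · obtain ⟨e₁, e₂⟩ := hψ (fun i => a i (join x y t i)) fun j => rfl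
    rw [compSeq_eq_prod, h₂, List.map_append, List.map_cons, List.map_cons, e₁, e₂,
      List.prod_append, List.prod_cons, List.prod_cons]
    rfl
  · let φ : Fin (r + 2) → Module.End K E :=
      Fin.cons (b x) (Fin.cons 0 fun j => a j.succ.succ (t j))
    obtain ⟨e₁, e₂⟩ := hψ φ fun j => rfl
    have h : (List.ofFn τ).map (fun i => (Fin.cons b fun i : Fin r => a i.succ.succ :
        Fin (r + 1) → EDist1 K E) i ((Fin.cons x t : Fin (r + 1) → Idx K) i)) =
          (List.ofFn fun j => Fin.succAbove 1 (τ j)).map φ := by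
      rw [List.map_ofFn, List.map_ofFn]
      congr 1
      funext j
      rw [Function.comp_apply, Function.comp_apply]
      generalize τ j = i
      refine Fin.cases rfl (fun i => ?_) i
      rw [one_succAbove_succ]
      rfl
    rw [compSeq_eq_prod, h, h₁, List.map_append, List.map_cons, e₁, e₂, List.prod_append,
      List.prod_cons]
    rfl

lemma ite_mul_ite_parity (P : Prop) [Decidable P] (p p' q : ZMod 2) :
    (if P ∧ p = 1 ∧ q = 1 then (-1 : K) else 1) * (if P ∧ p' = 1 ∧ q = 1 then (-1 : K) else 1) =
      if P ∧ p + p' = 1 ∧ q = 1 then (-1 : K) else 1 := by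
  have h : ∀ x : ZMod 2, x = 0 ∨ x = 1 := by decide
  have h2 : (1 : ZMod 2) + 1 = 0 := by decide
  by_cases hP : P ∧ q = 1
  · rcases h p with rfl | rfl <;> rcases h p' with rfl | rfl <;> simp [hP, h2]
  · have h3 : ∀ x : ZMod 2, ¬(P ∧ x = 1 ∧ q = 1) := fun x hx => hP ⟨hx.1, hx.2.2⟩
    rw [if_neg (h3 _), if_neg (h3 _), if_neg (h3 _), one_mul]

lemma koszulPerm_liftPerm (ps : Fin (r + 2) → ZMod 2) (τ : Equiv.Perm (Fin (r + 1))) :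
    koszulPerm K ps (liftPerm τ) =
      koszulPerm K (Fin.cons (ps 0 + ps 1) fun i : Fin r => ps i.succ.succ) τ := by
  have h : ∀ p, ((liftPerm τ).symm (pairSnd p) < (liftPerm τ).symm (pairFst p)) ↔
      τ.symm (collapse (pairSnd p)) < τ.symm (collapse (pairFst (r := r) p)) := fun p =>
    liftPerm_symm_lt_iff τ _ _ (collapse_pairFst_lt p).ne'
  have h01 : ¬((liftPerm τ).symm 1 < (liftPerm τ).symm 0 ∧ ps 0 = 1 ∧ ps 1 = 1) := fun h =>
    (liftPerm_symm_zero_lt τ).not_gt h.1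
  rw [koszulPerm, koszulPerm, ← consConsPairs.prod_comp, ← consPairs.prod_comp,
    Fintype.prod_sum_type, Fintype.prod_sum_type, Fintype.prod_sum_type, Fintype.prod_sum_type,
    ← Finset.prod_mul_distrib, Fintype.prod_unique]
  have e : ∀ p, (consConsPairs (Sum.inr p) : Pairs (r + 2)).1 = (pairFst p, pairSnd p) :=
    fun _ => rfl
  simp only [e, h]
  rw [show (consConsPairs (Sum.inl default) : Pairs (r + 2)).1 = (0, 1) from rfl, if_neg h01,
    one_mul]
  congr 1
  exact Finset.prod_congr rfl fun j _ => ite_mul_ite_parity _ _ _ _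

end Lifting

section Product

variable {K : Type*} [Field K] [CharZero K] {E : Type*} [AddCommGroup E] [Module K E] {r : ℕ}

lemma InLat2.map (f : E →ₗ[K] E) {c : Dist2 K E} (hc : InLat2 K E c) :
    InLat2 K E fun x y => f (c x y) := by
  obtain ⟨S, hS⟩ := hc
  exact ⟨S, fun x y hxy => hS x y fun h0 => hxy ((congrArg f h0).trans (map_zero f))⟩

lemma finite_exponents_zwPow (h : Idx K) {c : Dist2 K E} (hc : InLat2 K E c) (m k : Idx K) :
    {i : ℕ × ℕ | c (m.1 + h.1 - i.1, m.2 + h.2 - i.2) (k.1 + i.1, k.2 + i.2) ≠ 0}.Finite := by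
  have hinj : Function.Injective fun i : ℕ × ℕ => ((k.1 + i.1, k.2 + i.2) : Idx K) :=
    fun i j hij => by simpa [Prod.ext_iff] using hij
  refine ((hc.finite_antidiagonal (m + h + k)).preimage hinj.injOn).subset fun i hi => ?_
  rw [Set.mem_preimage, Set.mem_ofPred_eq]
  have e : m + h + k - (k.1 + i.1, k.2 + i.2) = (m.1 + h.1 - i.1, m.2 + h.2 - i.2) :=
    Prod.ext (by simp only [Prod.fst_sub, Prod.fst_add]; ring)
      (by simp only [Prod.snd_sub, Prod.snd_add]; ring)
  rw [e]
  exact hi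

lemma map_zwPow (f : E →ₗ[K] E) (h : Idx K) {c : Dist2 K E} (hc : InLat2 K E c) (m k : Idx K) :
    f (zwPow K E h c m k) = zwPow K E h (fun x y => f (c x y)) m k := by
  rw [zwPow, map_finsum f ((finite_exponents_zwPow h hc m k).subset fun i hi =>
    right_ne_zero_of_smul hi)]
  exact finsum_congr fun i => map_smul f _ _

/-- the coefficients of `∂_z^{(e₁)} ∂_z̄^{(e₂)}` -/
def ddCoef (e x : Idx K) : K :=
  natExt (fun j => gchoose K (e.1 - 1 - x.1) j) e.1 *
    natExt (fun j => gchoose K (e.2 - 1 - x.2) j) e.2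

lemma diag_ddPow2_eq_finsum (e : Idx K) (c : Dist2 K E) (m : Idx K) :
    diag K E (ddPow2 K E e c) m = ∑ᶠ x, ddCoef e x • c (x - e) (m - x - 1) := by
  refine finsum_congr fun x => ?_
  rw [ddPow2, dPow_d1z, dPow_d1zb, smul_smul]
  rfl

lemma finite_diag_ddPow2 (e : Idx K) {c : Dist2 K E} (hc : InLat2 K E c) (m : Idx K) :
    {x | ddCoef e x • c (x - e) (m - x - 1) ≠ 0}.Finite := by
  have hinj : Function.Injective fun x : Idx K => m - x - 1 := fun x y hxy => by
    simpa using hxy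
  refine ((hc.finite_antidiagonal (m - 1 - e)).preimage hinj.injOn).subset fun x hx => ?_
  rw [Set.mem_preimage, Set.mem_ofPred_eq]
  convert right_ne_zero_of_smul hx using 2
  abel

lemma map_diag_ddPow2 (f : E →ₗ[K] E) (e : Idx K) {c : Dist2 K E} (hc : InLat2 K E c) (m : Idx K) :
    f (diag K E (ddPow2 K E e c) m) = diag K E (ddPow2 K E e fun x y => f (c x y)) m := by
  rw [diag_ddPow2_eq_finsum, diag_ddPow2_eq_finsum, map_finsum f (finite_diag_ddPow2 e hc m)]
  exact finsum_congr fun x => map_smul f _ _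

/-- the product of two fields with given operator product expansion -/
def prodField {s : ℕ} (c : Fin s → EDist2 K E) (hc : ∀ i, IsField2D K E (c i)) (h : Fin s → Idx K)
    (n : Idx K) : EDist1 K E := fun m =>
  { toFun := fun v => prodAt K E c h n v m
    map_add' := fun v w => by
      rw [prodAt, prodAt, prodAt, ← Finset.sum_add_distrib]
      refine Finset.sum_congr rfl fun i _ => ?_
      rw [diag_ddPow2_eq_finsum, diag_ddPow2_eq_finsum, diag_ddPow2_eq_finsum, ← finsum_add_distrib
        (finite_diag_ddPow2 _ (hc i v) m) (finite_diag_ddPow2 _ (hc i w) m)]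
      refine finsum_congr fun x => ?_
      rw [← smul_add]
      exact congrArg _ (map_add (c i _ _) v w)
    map_smul' := fun k v => by
      rw [prodAt, prodAt, RingHom.id_apply, Finset.smul_sum]
      refine Finset.sum_congr rfl fun i _ => ?_
      rw [diag_ddPow2_eq_finsum, diag_ddPow2_eq_finsum, smul_finsum]
      refine finsum_congr fun x => ?_
      rw [smul_comm]
      exact congrArg _ (map_smul (c i _ _) k v) }

/-- a difference of two operator product expansions determines the difference of the products -/
lemma sum_diag_eq_sum_diag {ι κ : Type*} [Fintype ι] [Fintype κ] {c : ι → Dist2 K E}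
    (hc : ∀ i, InLat2 K E (c i)) (h : ι → Idx K) {d : κ → Dist2 K E} (hd : ∀ i, InLat2 K E (d i))
    (g : κ → Idx K) (heq : ∀ x y, ∑ i, zwPow K E (-(h i)) (c i) x y =
      ∑ i, zwPow K E (-(g i)) (d i) x y) (n m : Idx K) :
    ∑ i, diag K E (ddPow2 K E ((h i).1 - 1 - n.1, (h i).2 - 1 - n.2) (c i)) m =
      ∑ i, diag K E (ddPow2 K E ((g i).1 - 1 - n.1, (g i).2 - 1 - n.2) (d i)) m := by
  have key := sum_diag_eq_zero_of_sum_zwPow_eq_zero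
    (Sum.elim c fun i x y => (-1 : Module.End K E) (d i x y)) (fun i => by
      rcases i with i | i
      · exact hc i
      · exact (hd i).map _) (Sum.elim h g) (fun x y => by
      simp only [Fintype.sum_sum_type, Sum.elim_inl, Sum.elim_inr, ← map_zwPow _ _ (hd _),
        ← map_sum, heq]
      simp) n m
  simp only [Fintype.sum_sum_type, Sum.elim_inl, Sum.elim_inr, ← map_diag_ddPow2 _ _ (hd _),
    ← map_sum] at key
  simpa [add_neg_eq_zero] using key

lemma smul_compSeq_prodField_eq {ι : Type*} [Fintype ι] {a : Fin (r + 2) → EDist1 K E}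
    {ps : Fin (r + 2) → ZMod 2} {g : ι → Pairs (r + 2) → Idx K} {C : ι → EDistN K E (r + 2)}
    (hC : ∀ α v, InLatN K E (evN K E (C α) v))
    (hope : ∀ σ v m, koszulPerm K ps σ • compSeq K E a σ m v =
      ∑ α, permMul K E σ (fun p => -(g α p)) (evN K E (C α) v) m)
    {s : ℕ} {c : Fin s → EDist2 K E} {h : Fin s → Idx K} (hc : ∀ i, IsField2D K E (c i))
    (hac : ∀ v x y, a 0 x (a 1 y v) = ∑ i, zwPow K E (-(h i)) (ev2 K E (c i) v) x y) (n : Idx K)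
    (τ : Equiv.Perm (Fin (r + 1))) (v : E) (m : Fin (r + 1) → Idx K) :
    koszulPerm K (Fin.cons (ps 0 + ps 1) fun i : Fin r => ps i.succ.succ) τ •
      compSeq K E (Fin.cons (prodField c hc h n) fun i : Fin r => a i.succ.succ :
        Fin (r + 1) → EDist1 K E) τ m v =
      ∑ α, diagN (ddFam ((g α (consConsPairs (Sum.inl ()))).1 - 1 - n.1,
          (g α (consConsPairs (Sum.inl ()))).2 - 1 - n.2)
        (restFam ((fun p => -(g α p)) ∘ consConsPairs ∘ Sum.inr) (C α)) τ v) m := by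
  obtain ⟨A, w, h₁, h₂⟩ := exists_compSeq_liftPerm a τ (Fin.tail m) v
  let f : Module.End K E := koszulPerm K ps (liftPerm τ) • A
  have key := sum_diag_eq_sum_diag (fun i => (hc i w).map f) h
    (fun α => inLat2_slice_restMul τ ((fun p => -(g α p)) ∘ consConsPairs ∘ Sum.inr)
      (hC α v) (Fin.tail m))
    (fun α => g α (consConsPairs (Sum.inl ()))) (fun x y => by
      have h3 := hope (liftPerm τ) v (join x y (Fin.tail m))
      rw [h₁, hac, Finset.sum_congr rfl fun α _ => permMul_eq_zwPow (liftPerm τ) τ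
        (liftPerm_symm_zero_lt τ) (liftPerm_symm_lt_iff τ) _ (hC α v) _] at h3
      rw [Finset.sum_congr rfl fun i _ => (map_zwPow f (-(h i)) (hc i w) x y).symm, ← map_sum]
      exact h3) n (m 0)
  have h4 := h₂ (prodField c hc h n) (m 0)
  rw [Fin.cons_self_tail] at h4
  rw [← koszulPerm_liftPerm, h4]
  rw [Finset.sum_congr rfl fun i _ => (map_diag_ddPow2 f _ (hc i w) (m 0)).symm, ← map_sum] at key
  refine key.trans (Finset.sum_congr rfl fun α _ => ?_)
  rw [diagN, slice_ddFam]
  rfl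

lemma multiplyLocal_prodField {ι : Type*} [Fintype ι] {a : Fin (r + 2) → EDist1 K E}
    {ps : Fin (r + 2) → ZMod 2} {g : ι → Pairs (r + 2) → Idx K} {C : ι → EDistN K E (r + 2)}
    (hg : ∀ α p, Kbar K (g α p)) (hC : ∀ α v, InLatN K E (evN K E (C α) v))
    (hope : ∀ σ v m, koszulPerm K ps σ • compSeq K E a σ m v =
      ∑ α, permMul K E σ (fun p => -(g α p)) (evN K E (C α) v) m)
    {s : ℕ} {c : Fin s → EDist2 K E} {h : Fin s → Idx K} (hc : ∀ i, IsField2D K E (c i))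
    (hac : ∀ v x y, a 0 x (a 1 y v) = ∑ i, zwPow K E (-(h i)) (ev2 K E (c i) v) x y) (n : Idx K) :
    MultiplyLocal K E
      (Fin.cons (prodField c hc h n) fun i : Fin r => a i.succ.succ : Fin (r + 1) → EDist1 K E)
      (Fin.cons (ps 0 + ps 1) fun i : Fin r => ps i.succ.succ) := by
  refine multiplyLocal_of_mem_permSpan ?_
  have key := sum_mem fun α (_ : α ∈ Finset.univ) => (diagN_mem_permSpan (ddFam_mem
    ((g α (consConsPairs (Sum.inl ()))).1 - 1 - n.1, (g α (consConsPairs (Sum.inl ()))).2 - 1 - n.2)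
    (restFam_mem (hs := (fun p => -(g α p)) ∘ consConsPairs ∘ Sum.inr) (fun p => (hg α _).neg)
      (hC α)))).2
  convert key using 1
  funext τ v m
  rw [smul_compSeq_prodField_eq hC hope hc hac n τ v m, Finset.sum_apply, Finset.sum_apply,
    Finset.sum_apply]

end Product

/-- Dong's lemma for multiple locality: if a¹(𝐳),…,aʳ(𝐳) are
multiply local (in particular a¹(𝐳), a²(𝐳) are local), then for every 𝐧 the
family a¹(𝐳)_(𝐧)a²(𝐳), a³(𝐳), …, aʳ(𝐳) is multiply local. -/
theorem stmt_7 (K : Type*) [Field K] [CharZero K]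
    (E : Type*) [AddCommGroup E] [Module K E]
    (evE odE : Submodule K E) (hgr : IsCompl evE odE)
    (r : ℕ) (a : Fin (r + 2) → EDist1 K E) (ps : Fin (r + 2) → ZMod 2)
    (hhom : ∀ i, EDistPar K evE odE (a i) (ps i))
    (hml : MultiplyLocal K E a ps)
    {s : ℕ} (c : Fin s → EDist2 K E) (h : Fin s → Idx K)
    (hope : IsOPE K E (ps 0) (ps 1) (a 0) (a 1) c h)
    (n : Idx K) :
    ∃ b : EDist1 K E,
      (∀ (v : E) (m : Idx K), ev1 K E b v m = prodAt K E c h n v m) ∧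
      MultiplyLocal K E
        (Fin.cons b (fun i : Fin r => a i.succ.succ) : Fin (r + 1) → EDist1 K E)
        (Fin.cons (ps 0 + ps 1) (fun i : Fin r => ps i.succ.succ)) := by
  obtain ⟨rij, hs, C, hK, hC, hml⟩ := hml
  exact ⟨prodField c hope.2.1 h n, fun v m => rfl,
    multiplyLocal_prodField (ι := (p : Pairs (r + 2)) → Fin (rij p.1.1 p.1.2))
      (g := fun α p => hs p.1.1 p.1.2 (α p)) (fun α p => hK _ _ (α p)) hC hml hope.2.1 hope.2.2.1 n⟩

end OPEA
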